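/- arXiv:2510.12846 — 6 statements merged into one kernel-verified Lean document; each statement's English description precedes it below -/
import Mathlib

section
/- Let A and B be n×n matrices with entries in {0,1}, viewed as the payoff matrices of the row and column player of a win-lose bimatrix game. If the bipartite digraph D(A,B) contains a stable 2ℓ-cycle with row set S and column set T, then the game has a mixed Nash equilibrium supported inside S × T: there exist vectors x, y ∈ ℝ^n with x_i ≥ 0 and y_j ≥ 0 for all i, j, Σ_i x_i = Σ_j y_j = 1, x_i = 0 for every i ∉ S, y_j = 0 for every j ∉ T, such that for every probability vector x₀ ∈ ℝ^n one has x₀ᵀ A y ≤ xᵀ A y, and for every probability vector y₀ ∈ ℝ^n one has xᵀ B y₀ ≤ xᵀ B y. -/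
open MeasureTheory Filter Finset
open scoped ENNReal

/-- A directed 2ℓ-cycle in the bipartite digraph D(A,B): ℓ distinct rows and ℓ distinct
columns with B(i_k, j_k) = 1 and A(i_{k+1}, j_k) = 1 for all k (indices mod ℓ). -/
def IsCycle (ℓ n : ℕ) (A B : Fin n → Fin n → Bool) (r c : ZMod ℓ → Fin n) : Prop :=
  Function.Injective r ∧ Function.Injective c ∧
    (∀ k, B (r k) (c k) = true) ∧ ∀ k, A (r (k + 1)) (c k) = true

/-- A stable 2ℓ-cycle: additionally, every row outside the cycle has at most one
out-neighbour (w.r.t. A) among the cycle's columns, and every column outside the cycle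
has at most one in-neighbour (w.r.t. B) among the cycle's rows. -/
def IsStableCycle (ℓ n : ℕ) (A B : Fin n → Fin n → Bool) (r c : ZMod ℓ → Fin n) : Prop :=
  IsCycle ℓ n A B r c ∧
    (∀ i : Fin n, i ∉ Set.range r →
      ∀ k k' : ZMod ℓ, A i (c k) = true → A i (c k') = true → c k = c k') ∧
    (∀ j : Fin n, j ∉ Set.range c →
      ∀ k k' : ZMod ℓ, B (r k) j = true → B (r k') j = true → r k = r k')

section Brouwer
open Metric RealInnerProductSpace

variable {E : Type*} [NormedAddCommGroup E] [InnerProductSpace ℝ E] [FiniteDimensional ℝ E]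

/-- The nearest-point projection onto a nonempty closed convex set. -/
theorem exists_lipschitz_projection {K : Set E} (hne : K.Nonempty) (hcl : IsClosed K)
    (hcv : Convex ℝ K) :
    ∃ P : E → E, LipschitzWith 1 P ∧ (∀ x, P x ∈ K) ∧
      ∀ x, ∀ w ∈ K, ⟪x - P x, w - P x⟫ ≤ 0 := by
  have h : ∀ x : E, ∃ v ∈ K, ∀ w ∈ K, ⟪x - v, w - v⟫ ≤ 0 := fun x => by
    obtain ⟨v, hv, h⟩ := exists_norm_eq_iInf_of_complete_convex hne hcl.isComplete hcv x
    exact ⟨v, hv, (norm_eq_iInf_iff_real_inner_le_zero hcv hv).1 h⟩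
  choose P hPK hP using h
  refine ⟨P, LipschitzWith.of_dist_le_mul fun x y => ?_, hPK, hP⟩
  rw [NNReal.coe_one, one_mul, dist_eq_norm, dist_eq_norm]
  have h1 := hP x (P y) (hPK y)
  have h2 := hP y (P x) (hPK x)
  have h3 : ‖P x - P y‖ ^ 2 ≤ ⟪x - y, P x - P y⟫ := by
    rw [← real_inner_self_eq_norm_sq]
    simp only [inner_sub_left, inner_sub_right] at h1 h2 ⊢
    simp only [real_inner_comm] at h1 h2 ⊢
    linarith [real_inner_comm (P x) (P y)]
  have h4 := real_inner_le_norm (x - y) (P x - P y)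
  rcases (norm_nonneg (P x - P y)).eq_or_lt with h0 | h0
  · rw [← h0]; positivity
  · nlinarith

/-- The value of the polynomial `t ↦ det (1 + t • M)` at `1` is a fixed affine combination of its
values at suitable nodes in `(0, ε)`. -/
theorem exists_det_extrapolation {ε : ℝ} (hε : 0 < ε) :
    ∃ (s : Finset ℕ) (w v : ℕ → ℝ), (∀ i, 0 < v i ∧ v i < ε) ∧ ∑ i ∈ s, w i = 1 ∧
      ∀ M : E →L[ℝ] E, (1 + M).det = ∑ i ∈ s, w i * (1 + v i • M).det := by
  classical
  let b := Module.finBasis ℝ E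
  let v : ℕ → ℝ := fun i => ε / (i + 2)
  let s := Finset.range (Module.finrank ℝ E + 1)
  have hv : Function.Injective v := fun i j h => by
    have : (i : ℝ) + 2 = j + 2 := by
      have hi : (0 : ℝ) < i + 2 := by positivity
      have hj : (0 : ℝ) < j + 2 := by positivity
      simp only [v] at h
      field_simp at h
      linarith
    exact_mod_cast add_right_cancel this
  have hinj : Set.InjOn v s := hv.injOn
  refine ⟨s, fun i => (Lagrange.basis s v i).eval 1, v, fun i => ⟨by positivity, ?_⟩, ?_, ?_⟩
  · exact div_lt_self hε (by linarith [(Nat.cast_nonneg i : (0 : ℝ) ≤ i)])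
  · rw [← Polynomial.eval_finsetSum, Lagrange.sum_basis hinj ⟨0, by simp [s]⟩, Polynomial.eval_one]
  · intro M
    let A := LinearMap.toMatrix b b (M : E →ₗ[ℝ] E)
    let p : Polynomial ℝ := Matrix.det
      ((Polynomial.X : Polynomial ℝ) • A.map Polynomial.C + (1 : Matrix _ _ ℝ).map Polynomial.C)
    have hp : ∀ t : ℝ, (1 + t • M).det = p.eval t := fun t => by
      have h1 : (1 + t • M).det = (1 + t • A).det := by
        rw [ContinuousLinearMap.det, ← LinearMap.det_toMatrix b]
        congr 1
        have : ((1 + t • M : E →L[ℝ] E) : E →ₗ[ℝ] E) = LinearMap.id + t • (M : E →ₗ[ℝ] E) := rfl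
        rw [this, map_add, map_smul, LinearMap.toMatrix_id]
      rw [h1, ← Polynomial.coe_evalRingHom, RingHom.map_det]
      congr 1
      ext i j
      by_cases hij : i = j <;> simp [hij, add_comm, mul_comm t]
    have hdeg : p.degree < #s := by
      refine Polynomial.degree_le_natDegree.trans_lt (Nat.cast_lt.2 ?_)
      have := Polynomial.natDegree_det_X_add_C_le A 1
      rw [Fintype.card_fin] at this
      rw [Finset.card_range]
      exact Nat.lt_succ_of_le this
    have h1 := hp 1
    rw [one_smul] at h1
    rw [h1]
    conv_lhs => rw [Lagrange.eq_interpolate hinj hdeg]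
    simp [Lagrange.interpolate_apply, Polynomial.eval_finsetSum, hp, mul_comm]

/-- There is no `C¹` retraction `x ↦ x + g x` of the closed unit ball onto the unit sphere. -/
theorem not_retraction_ball [MeasurableSpace E] [BorelSpace E] {g : E → E} {g' : E → E →L[ℝ] E}
    (hg : ∀ x ∈ closedBall (0 : E) 1, HasFDerivAt g (g' x) x)
    (hg' : ContinuousOn g' (closedBall 0 1)) (h0 : ∀ x, ‖x‖ = 1 → g x = 0)
    (h1 : ∀ x, ‖x‖ ≤ 1 → ‖x + g x‖ = 1) : False := by
  obtain ⟨P, hPL, hPB, hP⟩ := exists_lipschitz_projection (K := closedBall (0 : E) 1)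
    ⟨0, by simp⟩ isClosed_closedBall (convex_closedBall _ _)
  have hP' : ∀ x, P x = x ∨ ‖P x‖ = 1 := fun x => by
    by_contra! hx
    have hlt : ‖P x‖ < 1 := lt_of_le_of_ne (by simpa using hPB x) hx.2
    have hd : 0 < ‖x - P x‖ := norm_pos_iff.2 (sub_ne_zero.2 (Ne.symm hx.1))
    have := hP x (P x + ((1 - ‖P x‖) / ‖x - P x‖) • (x - P x)) (by
      rw [mem_closedBall_zero_iff]
      refine (norm_add_le _ _).trans ?_
      rw [norm_smul, Real.norm_of_nonneg (div_nonneg (by linarith) hd.le),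
        div_mul_cancel₀ _ hd.ne']
      linarith)
    rw [add_sub_cancel_left, inner_smul_right, real_inner_self_eq_norm_sq] at this
    have : 0 < (1 - ‖P x‖) / ‖x - P x‖ * ‖x - P x‖ ^ 2 :=
      mul_pos (div_pos (by linarith) hd) (by positivity)
    linarith
  obtain ⟨C, hC⟩ := (isCompact_closedBall (0 : E) 1).exists_bound_of_continuousOn hg'
  set L : NNReal := C.toNNReal
  have hgL : LipschitzOnWith L g (closedBall 0 1) :=
    (convex_closedBall (0 : E) 1).lipschitzOnWith_of_nnnorm_hasFDerivWithin_le
      (fun x hx => (hg x hx).hasFDerivWithinAt) fun x hx => by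
        rw [← NNReal.coe_le_coe, coe_nnnorm]
        exact (hC x hx).trans (Real.le_coe_toNNReal C)
  have hgP : LipschitzWith L (g ∘ P) := by
    have := hgL.comp (hPL.lipschitzOnWith (s := Set.univ)) (fun x _ => hPB x)
    rwa [mul_one, lipschitzOnWith_univ] at this
  obtain ⟨δ, hδ, hdet⟩ : ∃ δ > 0, ∀ M : E →L[ℝ] E, ‖M‖ < δ → 0 < (1 + M).det := by
    have : ContinuousAt (fun M : E →L[ℝ] E => (1 + M).det) 0 :=
      (ContinuousLinearMap.continuous_det.comp (by fun_prop)).continuousAt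
    have h2 : ∀ᶠ M in nhds (0 : E →L[ℝ] E), 0 < (1 + M).det := by
      refine this.eventually (lt_mem_nhds ?_)
      simp [ContinuousLinearMap.det]
    obtain ⟨δ, hδ, h⟩ := Metric.eventually_nhds_iff.1 h2
    exact ⟨δ, hδ, fun M hM => h (by simpa using hM)⟩
  have hL0 : (0 : ℝ) ≤ L := L.2
  obtain ⟨ε, hε, hε1, hεL, hεδ⟩ : ∃ ε : ℝ, 0 < ε ∧ ε ≤ 1 ∧ ε * (L + 1) ≤ 1 ∧ ε * (L + 1) ≤ δ := by
    refine ⟨min 1 δ / (L + 1), by positivity, ?_, ?_, ?_⟩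
    · exact div_le_one_of_le₀ ((min_le_left _ _).trans (by linarith)) (by positivity)
    · rw [div_mul_cancel₀ _ (by positivity)]
      exact min_le_left _ _
    · rw [div_mul_cancel₀ _ (by positivity)]
      exact min_le_right _ _
  have key : ∀ t : ℝ, 0 < t → t < ε →
      ∫ x in ball (0 : E) 1, (1 + t • g' x).det = volume.real (ball (0 : E) 1) := by
    intro t ht htε
    have htL' : t * L < ε * (L + 1) := by nlinarith
    have htL : t * L < 1 := htL'.trans_le hεL
    have hcontr : ∀ x ∈ closedBall (0 : E) 1, ∀ y ∈ closedBall (0 : E) 1,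
        x + t • g x = y + t • g y → x = y := by
      intro x hx y hy hxy
      have h2 := hgL.dist_le_mul x hx y hy
      have h3 : x - y = t • (g y - g x) := by
        rw [smul_sub, sub_eq_sub_iff_add_eq_add, hxy, add_comm]
      have h4 : dist x y = t * dist (g x) (g y) := by
        rw [dist_eq_norm, h3, norm_smul, Real.norm_of_nonneg ht.le, dist_comm, dist_eq_norm]
      by_contra hne
      have : 0 < dist x y := dist_pos.2 hne
      nlinarith
    have himg : (fun x => x + t • g x) '' ball 0 1 = ball (0 : E) 1 := by
      ext y
      simp only [Set.mem_image, mem_ball_zero_iff]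
      constructor
      · rintro ⟨x, hx, rfl⟩
        have : x + t • g x = (1 - t) • x + t • (x + g x) := by module
        rw [this]
        refine (norm_add_le _ _).trans_lt ?_
        rw [norm_smul, norm_smul, h1 x hx.le, Real.norm_of_nonneg ht.le,
          Real.norm_of_nonneg (by linarith)]
        nlinarith
      · intro hy
        have hK : ContractingWith (t.toNNReal * L) (fun x => y - t • (g ∘ P) x) := by
          refine ⟨?_, LipschitzWith.of_dist_le_mul fun a b => ?_⟩
          · rw [← NNReal.coe_lt_coe]
            simpa [ht.le] using htL
          · have := hgP.dist_le_mul a b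
            rw [NNReal.coe_mul, Real.coe_toNNReal _ ht.le, dist_eq_norm, sub_sub_sub_cancel_left,
              ← smul_sub, norm_smul, Real.norm_of_nonneg ht.le, ← dist_eq_norm, dist_comm, mul_assoc]
            gcongr
        have hfix := hK.fixedPoint_isFixedPt
        set x := ContractingWith.fixedPoint (fun x => y - t • (g ∘ P) x) hK
        have hx : y - t • g (P x) = x := hfix
        have hy' : x + t • g (P x) = y := (sub_eq_iff_eq_add.1 hx).symm
        rcases hP' x with h | h
        · rw [h] at hy'
          refine ⟨x, lt_of_le_of_ne (by simpa [h] using hPB x) fun hx1 => ?_, hy'⟩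
          rw [h0 x hx1, smul_zero, add_zero] at hy'
          rw [hy'] at hx1; linarith
        · rw [h0 _ h, smul_zero, add_zero] at hy'
          have h2 := hP x x (by rw [hy']; simpa using hy.le)
          rw [real_inner_self_nonpos, sub_eq_zero] at h2
          rw [← h2, hy'] at h
          linarith
    have hcv := integral_image_eq_integral_abs_det_fderiv_smul volume
      (s := ball (0 : E) 1) (f := fun x => x + t • g x) (f' := fun x => 1 + t • g' x)
      measurableSet_ball
      (fun x hx => ((hasFDerivAt_id x).add
        ((hg x (ball_subset_closedBall hx)).const_smul t)).hasFDerivWithinAt)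
      (fun x hx y hy => hcontr x (ball_subset_closedBall hx) y (ball_subset_closedBall hy))
      (fun _ => (1 : ℝ))
    rw [himg] at hcv
    have h5 : ∫ x in ball (0 : E) 1, (1 + t • g' x).det =
        ∫ x in ball (0 : E) 1, |(1 + t • g' x).det| • (1 : ℝ) := by
      refine setIntegral_congr_fun measurableSet_ball fun x hx => ?_
      have hx' := hC x (ball_subset_closedBall hx)
      have : 0 < (1 + t • g' x).det := by
        apply hdet
        rw [norm_smul, Real.norm_of_nonneg ht.le]
        calc t * ‖g' x‖ ≤ t * L := by
              gcongr
              exact hx'.trans (Real.le_coe_toNNReal C)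
          _ < δ := htL'.trans_le hεδ
      rw [abs_of_pos this, smul_eq_mul, mul_one]
    rw [h5, ← hcv]
    simp
  obtain ⟨s, w, v, hv, hw, hdetw⟩ := exists_det_extrapolation (E := E) hε
  have hint : ∀ t : ℝ, IntegrableOn (fun x => (1 + t • g' x).det) (ball (0 : E) 1) := fun t => by
    refine (ContinuousOn.integrableOn_compact (isCompact_closedBall (0 : E) 1) ?_).mono_set
      ball_subset_closedBall
    exact ContinuousLinearMap.continuous_det.comp_continuousOn (by fun_prop)
  have hone : ∫ x in ball (0 : E) 1, (1 + g' x).det = volume.real (ball (0 : E) 1) := by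
    rw [show (fun x => (1 + g' x).det) = fun x => ∑ i ∈ s, w i * (1 + v i • g' x).det from
      funext fun x => hdetw _]
    rw [integral_finsetSum _ fun i _ => (hint (v i)).const_mul _]
    simp_rw [integral_const_mul, key _ (hv _).1 (hv _).2]
    rw [← Finset.sum_mul, hw, one_mul]
  have hzero : ∫ x in ball (0 : E) 1, (1 + g' x).det = 0 := by
    refine setIntegral_eq_zero_of_forall_eq_zero fun x hx => ?_
    have hx' : ‖x‖ < 1 := by simpa using hx
    have hD : HasFDerivAt (fun y => y + g y) (1 + g' x) x :=
      (hasFDerivAt_id x).add (hg x (ball_subset_closedBall hx))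
    have hD2 := hD.norm_sq
    have hD3 : HasFDerivAt (fun y => ‖y + g y‖ ^ 2) (0 : E →L[ℝ] ℝ) x := by
      refine (hasFDerivAt_const (1 : ℝ) x).congr_of_eventuallyEq ?_
      filter_upwards [isOpen_ball.mem_nhds hx] with y hy
      rw [h1 y (by simpa using (ball_subset_closedBall hy)), one_pow]
    by_contra hne
    have hu : IsUnit ((1 + g' x : E →L[ℝ] E) : E →ₗ[ℝ] E) :=
      (LinearMap.isUnit_iff_isUnit_det _).2 (isUnit_iff_ne_zero.2 hne)
    obtain ⟨z, hz⟩ := LinearMap.range_eq_top.1 ((LinearMap.isUnit_iff_range_eq_top _).1 hu) (x + g x)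
    have h6 := congrArg (fun φ : E →L[ℝ] ℝ => φ z) (hD2.unique hD3)
    have hz' : (1 + g' x) z = x + g x := hz
    have h7 : 2 * ⟪x + g x, (1 + g' x) z⟫ = 0 := by
      simp [inner_add_left, inner_add_right] at h6 ⊢
      linarith
    rw [hz', real_inner_self_eq_norm_sq, h1 x hx'.le] at h7
    norm_num at h7
  have hpos : 0 < volume.real (ball (0 : E) 1) :=
    ENNReal.toReal_pos (measure_ball_pos _ _ one_pos).ne' measure_ball_lt_top.ne
  linarith


/-- Brouwer's fixed point theorem for `C¹` maps into the open unit ball. -/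
theorem exists_fixedPoint_of_contDiff {p : E → E} (hp : ContDiff ℝ 1 p) (hp1 : ∀ x, ‖p x‖ < 1) :
    ∃ x, p x = x := by
  borelize E
  by_contra! hne
  let u : E → E := fun x => x - p x
  let Q : E → ℝ := fun x => ⟪x, u x⟫ ^ 2 + ‖u x‖ ^ 2 * (1 - ‖x‖ ^ 2)
  let lam : E → ℝ := fun x => (-⟪x, u x⟫ + √(Q x)) / ‖u x‖ ^ 2
  have hu : ∀ x, 0 < ‖u x‖ := fun x => norm_pos_iff.2 (sub_ne_zero.2 (hne x).symm)
  have hb : ∀ x, ‖x‖ = 1 → 0 < ⟪x, u x⟫ := fun x hx => by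
    have h := real_inner_le_norm x (p x)
    have := hp1 x
    simp only [u, inner_sub_right, real_inner_self_eq_norm_sq, hx] at h ⊢
    linarith
  have hQ : ∀ x, ‖x‖ ≤ 1 → 0 < Q x := fun x hx => by
    rcases hx.eq_or_lt with h | h
    · have := hb x h
      simp only [Q, h]
      nlinarith
    · have h1 : 0 < 1 - ‖x‖ ^ 2 := by nlinarith [norm_nonneg x]
      have := mul_pos (pow_pos (hu x) 2) h1
      have := sq_nonneg ⟪x, u x⟫
      simp only [Q]
      linarith
  have hud : ContDiff ℝ 1 u := contDiff_id.sub hp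
  have hQd : ContDiff ℝ 1 Q :=
    ((contDiff_id.inner ℝ hud).pow 2).add
      ((hud.norm_sq ℝ).mul (contDiff_const.sub (contDiff_id.norm_sq ℝ)))
  have hgd : ∀ x ∈ closedBall (0 : E) 1, ContDiffAt ℝ 1 (fun x => lam x • u x) x := fun x hx => by
    have hx' : ‖x‖ ≤ 1 := by simpa using hx
    exact (((contDiff_id.inner ℝ hud).neg.contDiffAt.add
      (hQd.contDiffAt.sqrt (hQ x hx').ne')).div (hud.norm_sq ℝ).contDiffAt
        (pow_pos (hu x) 2).ne').smul hud.contDiffAt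
  refine not_retraction_ball (g := fun x => lam x • u x) (g' := fderiv ℝ fun x => lam x • u x)
    (fun x hx => ((hgd x hx).differentiableAt one_ne_zero).hasFDerivAt)
    (fun x hx => ((hgd x hx).fderiv_right (m := 0) le_rfl).continuousAt.continuousWithinAt)
    (fun x hx => ?_) (fun x hx => ?_)
  · have : √(Q x) = ⟪x, u x⟫ := by
      simp only [Q, hx, one_pow, sub_self, mul_zero, add_zero]
      exact Real.sqrt_sq (hb x hx).le
    simp [lam, this]
  · have h1 : lam x * ‖u x‖ ^ 2 = -⟪x, u x⟫ + √(Q x) :=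
      div_mul_cancel₀ _ (pow_pos (hu x) 2).ne'
    have h2 : √(Q x) ^ 2 = ⟪x, u x⟫ ^ 2 + ‖u x‖ ^ 2 * (1 - ‖x‖ ^ 2) := Real.sq_sqrt (hQ x hx).le
    have h3 : ‖x + lam x • u x‖ ^ 2 = 1 := by
      rw [norm_add_sq_real, inner_smul_right, norm_smul, mul_pow, Real.norm_eq_abs, sq_abs]
      refine mul_left_cancel₀ (pow_pos (hu x) 2).ne' ?_
      rw [show √(Q x) = lam x * ‖u x‖ ^ 2 + ⟪x, u x⟫ by linarith] at h2
      linear_combination h2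
    exact (pow_eq_one_iff_of_nonneg (norm_nonneg _) two_ne_zero).1 h3

/-- Brouwer's fixed point theorem for bounded continuous maps. -/
theorem exists_fixedPoint_of_continuous {f : E → E} (hf : Continuous f) {R : ℝ}
    (hR : ∀ x, ‖f x‖ ≤ R) : ∃ x, f x = x := by
  have hR0 : 0 ≤ R := (norm_nonneg _).trans (hR 0)
  have happrox : ∀ ε : ℝ, 0 < ε → ε ≤ 1 → ∃ x ∈ closedBall (0 : E) (R + 1), ‖f x - x‖ ≤ ε := by
    intro ε hε hε1
    obtain ⟨q, hq, hqf, -⟩ := hf.exists_contDiff_approx 1 (ε := fun _ => ε) continuous_const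
      fun _ => hε
    have hqR : ∀ x, ‖q x‖ < R + 1 := fun x => by
      have h1 := hqf x
      rw [dist_eq_norm] at h1
      calc ‖q x‖ = ‖f x + (q x - f x)‖ := by rw [add_sub_cancel]
        _ ≤ ‖f x‖ + ‖q x - f x‖ := norm_add_le _ _
        _ < R + 1 := by linarith [hR x]
    have hpos : 0 < R + 1 := by linarith
    obtain ⟨x, hx⟩ := exists_fixedPoint_of_contDiff
      (p := fun x => (R + 1)⁻¹ • q ((R + 1) • x))
      ((hq.comp (contDiff_id.const_smul (R + 1))).const_smul (R + 1)⁻¹) (fun x => by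
        rw [norm_smul, Real.norm_of_nonneg (by positivity), inv_mul_lt_one₀ hpos]
        exact hqR _)
    have hx' : q ((R + 1) • x) = (R + 1) • x := by
      conv_rhs => rw [← hx, smul_inv_smul₀ hpos.ne']
    refine ⟨(R + 1) • x, ?_, ?_⟩
    · rw [mem_closedBall_zero_iff, ← hx']
      exact (hqR _).le
    · conv_lhs => enter [1, 2]; rw [← hx']
      rw [← dist_eq_norm, dist_comm]
      exact (hqf _).le
  obtain ⟨x, -, hmin⟩ := (isCompact_closedBall (0 : E) (R + 1)).exists_isMinOn
    ⟨0, by simpa using by linarith⟩ (hf.sub continuous_id).norm.continuousOn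
  refine ⟨x, ?_⟩
  by_contra hne
  have hpos : 0 < ‖f x - x‖ := norm_pos_iff.2 (sub_ne_zero.2 hne)
  obtain ⟨y, hy, hyle⟩ := happrox (min (‖f x - x‖ / 2) 1) (by positivity) (min_le_right _ _)
  have h1 : ‖f x - x‖ ≤ ‖f y - y‖ := hmin hy
  have h2 := min_le_left (‖f x - x‖ / 2) 1
  linarith

/-- The Hartman–Stampacchia theorem: variational inequalities on compact convex sets are solvable. -/
theorem exists_variational_inequality {K : Set E} (hne : K.Nonempty) (hK : IsCompact K)
    (hcv : Convex ℝ K) {G : E → E} (hG : Continuous G) :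
    ∃ z ∈ K, ∀ w ∈ K, ⟪G z, w - z⟫ ≤ 0 := by
  obtain ⟨P, hPL, hPK, hP⟩ := exists_lipschitz_projection hne hK.isClosed hcv
  obtain ⟨R, hR⟩ := hK.isBounded.exists_norm_le
  obtain ⟨z, hz⟩ := exists_fixedPoint_of_continuous
    (hPL.continuous.comp (continuous_id.add hG)) (R := R) fun x => hR _ (hPK _)
  have hz' : P (z + G z) = z := hz
  refine ⟨z, hz' ▸ hPK _, fun w hw => ?_⟩
  have := hP (z + G z) w hw
  rwa [hz', add_sub_cancel_left] at this

end Brouwer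

theorem pi_single_one_mem_simplex {α : Type*} [Fintype α] [DecidableEq α] {U : Set α} {a : α}
    (ha : a ∈ U) : (∀ b, 0 ≤ (Pi.single a 1 : α → ℝ) b) ∧ ∑ b, (Pi.single a 1 : α → ℝ) b = 1 ∧
      ∀ b ∉ U, (Pi.single a 1 : α → ℝ) b = 0 := by
  refine ⟨fun b => ?_, by simp, fun b hb => Pi.single_eq_of_ne (fun h : b = a => hb (by rwa [h])) 1⟩
  rw [Pi.single_apply]
  split_ifs <;> norm_num

/-- Nash's theorem for the bimatrix game restricted to the rows in `S` and the columns in `T`. -/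
theorem exists_nash_of_support {ι κ : Type*} [Fintype ι] [Fintype κ] (A B : ι → κ → ℝ)
    {S : Set ι} {T : Set κ} (hS : S.Nonempty) (hT : T.Nonempty) :
    ∃ (x : ι → ℝ) (y : κ → ℝ), (∀ i, 0 ≤ x i) ∧ (∀ j, 0 ≤ y j) ∧
      ∑ i, x i = 1 ∧ ∑ j, y j = 1 ∧ (∀ i ∉ S, x i = 0) ∧ (∀ j ∉ T, y j = 0) ∧
      (∀ i ∈ S, ∑ j, A i j * y j ≤ ∑ k, x k * ∑ j, A k j * y j) ∧
      (∀ j ∈ T, ∑ i, B i j * x i ≤ ∑ k, y k * ∑ i, B i k * x i) := by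
  classical
  let K : Set (EuclideanSpace ℝ (ι ⊕ κ)) := {z | (∀ a, 0 ≤ z a) ∧ ∑ i, z (.inl i) = 1 ∧
    ∑ j, z (.inr j) = 1 ∧ (∀ i ∉ S, z (.inl i) = 0) ∧ ∀ j ∉ T, z (.inr j) = 0}
  have hmem : ∀ {x : ι → ℝ} {y : κ → ℝ}, (∀ i, 0 ≤ x i) → (∀ j, 0 ≤ y j) → ∑ i, x i = 1 →
      ∑ j, y j = 1 → (∀ i ∉ S, x i = 0) → (∀ j ∉ T, y j = 0) →
      WithLp.toLp 2 (Sum.elim x y) ∈ K := fun hx hy hx1 hy1 hxS hyT =>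
    ⟨fun a => by cases a <;> simp [hx, hy], by simpa using hx1, by simpa using hy1,
      by simpa using hxS, by simpa using hyT⟩
  have hcl : IsClosed K := by
    simp only [K, Set.ofPred_and, Set.ofPred_forall]
    refine IsClosed.inter (isClosed_iInter fun a => isClosed_le (by fun_prop) (by fun_prop)) <|
      (isClosed_eq (by fun_prop) (by fun_prop)).inter <|
      (isClosed_eq (by fun_prop) (by fun_prop)).inter <|
      (isClosed_iInter fun i => isClosed_iInter fun _ =>
        isClosed_eq (by fun_prop) (by fun_prop)).inter <|
      isClosed_iInter fun j => isClosed_iInter fun _ => isClosed_eq (by fun_prop) (by fun_prop)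
  have hbd : Bornology.IsBounded K := by
    refine (Metric.isBounded_closedBall (x := 0) (r := 2)).subset fun z hz => ?_
    obtain ⟨h0, h1, h2, -, -⟩ := hz
    have hle : ∀ a, z a ≤ 1 := fun a => by
      rcases a with i | j
      · exact h1 ▸ Finset.single_le_sum (f := fun i => z (.inl i)) (fun i _ => h0 _) (mem_univ i)
      · exact h2 ▸ Finset.single_le_sum (f := fun j => z (.inr j)) (fun j _ => h0 _) (mem_univ j)
    have hsq : ‖z‖ ^ 2 ≤ 2 := by
      rw [EuclideanSpace.norm_sq_eq]
      calc ∑ a, ‖z a‖ ^ 2 ≤ ∑ a, z a := Finset.sum_le_sum fun a _ => by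
            rw [Real.norm_of_nonneg (h0 a)]
            nlinarith [h0 a, hle a]
        _ = 2 := by rw [Fintype.sum_sum_type, h1, h2]; norm_num
    rw [mem_closedBall_zero_iff]
    nlinarith [norm_nonneg z]
  have hcv : Convex ℝ K := by
    intro z hz w hw s t hs ht hst
    obtain ⟨h0, h1, h2, h3, h4⟩ := hz
    obtain ⟨g0, g1, g2, g3, g4⟩ := hw
    refine ⟨fun a => ?_, ?_, ?_, fun i hi => ?_, fun j hj => ?_⟩
    · exact add_nonneg (mul_nonneg hs (h0 a)) (mul_nonneg ht (g0 a))
    · simp [Finset.sum_add_distrib, ← Finset.mul_sum, h1, g1, hst]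
    · simp [Finset.sum_add_distrib, ← Finset.mul_sum, h2, g2, hst]
    · simp [h3 i hi, g3 i hi]
    · simp [h4 j hj, g4 j hj]
  obtain ⟨i₀, hi₀⟩ := hS
  obtain ⟨j₀, hj₀⟩ := hT
  have hne : K.Nonempty := by
    obtain ⟨a0, a1, a2⟩ := pi_single_one_mem_simplex hi₀
    obtain ⟨b0, b1, b2⟩ := pi_single_one_mem_simplex hj₀
    exact ⟨_, hmem a0 b0 a1 b1 a2 b2⟩
  let G : EuclideanSpace ℝ (ι ⊕ κ) → EuclideanSpace ℝ (ι ⊕ κ) := fun z =>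
    WithLp.toLp 2 (Sum.elim (fun i => ∑ j, A i j * z (.inr j)) fun j => ∑ i, B i j * z (.inl i))
  have hG : Continuous G := by
    refine (PiLp.continuous_toLp 2 _).comp (continuous_pi fun a => ?_)
    rcases a with i | j <;> simp only [Sum.elim_inl, Sum.elim_inr] <;> fun_prop
  obtain ⟨z, ⟨h0, h1, h2, h3, h4⟩, hz⟩ := exists_variational_inequality hne
    (Metric.isCompact_of_isClosed_isBounded hcl hbd) hcv hG
  refine ⟨fun i => z (.inl i), fun j => z (.inr j), fun i => h0 _, fun j => h0 _, h1, h2, h3, h4,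
    fun i hi => ?_, fun j hj => ?_⟩
  · obtain ⟨a0, a1, a2⟩ := pi_single_one_mem_simplex hi
    have h := hz _ (hmem a0 (fun j => h0 (.inr j)) a1 h2 a2 h4)
    rw [PiLp.inner_apply, Fintype.sum_sum_type] at h
    simpa [G, sub_mul, Finset.sum_sub_distrib, Pi.single_apply] using h
  · obtain ⟨b0, b1, b2⟩ := pi_single_one_mem_simplex hj
    have h := hz _ (hmem (fun i => h0 (.inl i)) b0 h1 b1 h3 b2)
    rw [PiLp.inner_apply, Fintype.sum_sum_type] at h
    simpa [G, sub_mul, Finset.sum_sub_distrib, Pi.single_apply] using h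

/-- Under stability, a strategy outside the cycle pays no more than the best strategy in the cycle. -/
theorem payoff_le_of_stable {ι κ θ : Type*} [Fintype ι] [Fintype κ] {M : ι → κ → Bool}
    {r : θ → ι} {c : θ → κ} {σ : θ → θ} (hM : ∀ k, M (r (σ k)) (c k) = true)
    (hstable : ∀ i, i ∉ Set.range r →
      ∀ k k', M i (c k) = true → M i (c k') = true → c k = c k')
    {y : κ → ℝ} (hy : ∀ j, 0 ≤ y j) (hyT : ∀ j, j ∉ Set.range c → y j = 0) {v : ℝ} (hv : 0 ≤ v)
    (h : ∀ i ∈ Set.range r, ∑ j, (if M i j then (1 : ℝ) else 0) * y j ≤ v) (i : ι) :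
    ∑ j, (if M i j then (1 : ℝ) else 0) * y j ≤ v := by
  by_cases hi : i ∈ Set.range r
  · exact h i hi
  by_cases hk : ∃ k, M i (c k) = true
  · obtain ⟨k, hk⟩ := hk
    refine le_trans ?_ (h _ ⟨σ k, rfl⟩)
    have h1 : ∑ j, (if M i j then (1 : ℝ) else 0) * y j = y (c k) := by
      rw [Finset.sum_eq_single (c k)]
      · simp [hk]
      · intro j _ hj
        by_cases hjc : j ∈ Set.range c
        · obtain ⟨k', rfl⟩ := hjc
          rw [if_neg fun hk' => hj (hstable i hi k' k hk' hk), zero_mul]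
        · rw [hyT j hjc, mul_zero]
      · simp
    rw [h1]
    refine le_of_eq_of_le ?_ (Finset.single_le_sum
      (f := fun j => (if M (r (σ k)) j then (1 : ℝ) else 0) * y j) (fun j _ => ?_) (mem_univ (c k)))
    · simp [hM k]
    · exact mul_nonneg (by split_ifs <;> norm_num) (hy j)
  · refine le_of_eq_of_le (Finset.sum_eq_zero fun j _ => ?_) hv
    by_cases hjc : j ∈ Set.range c
    · obtain ⟨k', rfl⟩ := hjc
      rw [if_neg fun hk' => hk ⟨k', hk'⟩, zero_mul]
    · rw [hyT j hjc, mul_zero]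

theorem sum_mul_le_of_forall_le {ι : Type*} [Fintype ι] {p f : ι → ℝ} {v : ℝ}
    (hp : ∀ i, 0 ≤ p i) (hp1 : ∑ i, p i = 1) (hf : ∀ i, f i ≤ v) : ∑ i, p i * f i ≤ v := by
  calc ∑ i, p i * f i ≤ ∑ i, p i * v :=
        Finset.sum_le_sum fun i _ => mul_le_mul_of_nonneg_left (hf i) (hp i)
    _ = v := by rw [← Finset.sum_mul, hp1, one_mul]

theorem stable_cycle_gives_mixed_nash (n ℓ : ℕ) (hn : 1 ≤ n) (hℓ : 1 ≤ ℓ)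
    (A B : Fin n → Fin n → Bool) (r c : ZMod ℓ → Fin n)
    (hH : IsStableCycle ℓ n A B r c) :
    ∃ x y : Fin n → ℝ,
      (∀ i, 0 ≤ x i) ∧ (∀ j, 0 ≤ y j) ∧
      (∑ i, x i) = 1 ∧ (∑ j, y j) = 1 ∧
      (∀ i, i ∉ Set.range r → x i = 0) ∧
      (∀ j, j ∉ Set.range c → y j = 0) ∧
      (∀ x₀ : Fin n → ℝ, (∀ i, 0 ≤ x₀ i) → (∑ i, x₀ i) = 1 →
        ∑ i, ∑ j, x₀ i * (if A i j then (1 : ℝ) else 0) * y j ≤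
          ∑ i, ∑ j, x i * (if A i j then (1 : ℝ) else 0) * y j) ∧
      (∀ y₀ : Fin n → ℝ, (∀ j, 0 ≤ y₀ j) → (∑ j, y₀ j) = 1 →
        ∑ i, ∑ j, x i * (if B i j then (1 : ℝ) else 0) * y₀ j ≤
          ∑ i, ∑ j, x i * (if B i j then (1 : ℝ) else 0) * y j) := by
  obtain ⟨⟨-, -, hB, hA⟩, hAs, hBs⟩ := hH
  obtain ⟨x, y, hx, hy, hx1, hy1, hxS, hyT, hrow, hcol⟩ := exists_nash_of_support
    (fun i j => if A i j then (1 : ℝ) else 0) (fun i j => if B i j then (1 : ℝ) else 0)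
    (S := Set.range r) (T := Set.range c) ⟨r 0, 0, rfl⟩ ⟨c 0, 0, rfl⟩
  have h01 : ∀ b : Bool, (0 : ℝ) ≤ if b then 1 else 0 := fun b => by split_ifs <;> norm_num
  have hrow' := payoff_le_of_stable (σ := fun k => k + 1) hA hAs hy hyT
    (Finset.sum_nonneg fun k _ => mul_nonneg (hx k) <|
      Finset.sum_nonneg fun j _ => mul_nonneg (h01 _) (hy j)) hrow
  have hcol' := payoff_le_of_stable (M := fun j i => B i j) (σ := id) hB hBs hx hxS
    (Finset.sum_nonneg fun k _ => mul_nonneg (hy k) <|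
      Finset.sum_nonneg fun i _ => mul_nonneg (h01 _) (hx i)) hcol
  have eA : ∀ p : Fin n → ℝ, ∑ i, ∑ j, p i * (if A i j then (1 : ℝ) else 0) * y j =
      ∑ i, p i * ∑ j, (if A i j then (1 : ℝ) else 0) * y j := fun p => by
    simp only [Finset.mul_sum, mul_assoc]
  have eB : ∀ q : Fin n → ℝ, ∑ i, ∑ j, x i * (if B i j then (1 : ℝ) else 0) * q j =
      ∑ j, q j * ∑ i, (if B i j then (1 : ℝ) else 0) * x i := fun q => by
    rw [Finset.sum_comm]
    simp only [Finset.mul_sum]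
    exact Finset.sum_congr rfl fun j _ => Finset.sum_congr rfl fun i _ => by ring
  refine ⟨x, y, hx, hy, hx1, hy1, hxS, hyT, fun p hp hp1 => ?_, fun q hq hq1 => ?_⟩
  · rw [eA, eA]
    exact sum_mul_le_of_forall_le hp hp1 hrow'
  · rw [eB, eB]
    exact sum_mul_le_of_forall_le hq hq1 hcol'
end

section
/- There exists N₀ ∈ ℕ such that for all n ≥ N₀ and every real δ satisfying 8 log log n / log n ≤ δ ≤ (1/3)(1 - 4/log n) and δ ∉ (1/4 - 3/(2 log n), 1/4 + 2/log n), there exists an integer ℓ ≥ 2 with (1/(2ℓ))(1 + 4ℓ/log n) ≤ δ ≤ (1/(1+ℓ))(1 - 2ℓ/log n). -/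
open MeasureTheory Filter Finset
open scoped ENNReal

/-- The claim with `1 / log n` replaced by a small parameter `e`. -/
theorem exists_ell_of_small {e δ : ℝ} (he : 0 < e) (hlow : 38 * e ≤ δ)
    (hup : δ ≤ 1 / 3 * (1 - 4 * e)) (hgap : δ ≤ 1 / 4 - 3 / 2 * e ∨ 1 / 4 + 2 * e ≤ δ) :
    ∃ ℓ : ℕ, 2 ≤ ℓ ∧ 1 / (2 * (ℓ : ℝ)) + 2 * e ≤ δ ∧ δ * (1 + ℓ) ≤ 1 - 2 * ℓ * e := by
  rcases hgap with h | h
  · rcases le_total (1 / 6 + 2 * e) δ with h6 | h6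
    · refine ⟨3, by norm_num, ?_, ?_⟩ <;> push_cast <;> linarith
    · obtain ⟨d, rfl⟩ : ∃ d, δ = d + 2 * e := ⟨δ - 2 * e, by ring⟩
      have hd : 0 < d := by linarith
      have hle := Nat.le_ceil (1 / (2 * d))
      have hlt := Nat.ceil_lt_add_one (a := 1 / (2 * d)) (by positivity)
      set ℓ := ⌈1 / (2 * d)⌉₊
      have hthree : 3 ≤ 1 / (2 * d) := by
        rw [le_div_iff₀ (by positivity)]
        linarith
      have hℓ : (3 : ℝ) ≤ ℓ := hthree.trans hle
      refine ⟨ℓ, ?_, ?_, ?_⟩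
      · have : 3 ≤ ℓ := by exact_mod_cast hℓ
        omega
      · have : 1 / (2 * (ℓ : ℝ)) ≤ d := by
          rw [div_le_iff₀ (by positivity)] at hle ⊢
          linarith
        linarith
      · have hmul : (ℓ : ℝ) * (d + 4 * e) ≤ (1 / (2 * d) + 1) * (d + 4 * e) := by gcongr
        have hexp : (1 / (2 * d) + 1) * (d + 4 * e) = 1 / 2 + 2 * (e / d) + d + 4 * e := by
          field_simp
          ring
        have hratio : e / d ≤ 1 / 36 := by
          rw [div_le_iff₀ hd]
          linarith
        linarith
  · refine ⟨2, le_rfl, ?_, ?_⟩ <;> push_cast <;> linarith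

theorem ell_set_nonempty :
    ∃ N₀ : ℕ, ∀ n : ℕ, N₀ ≤ n → ∀ δ : ℝ,
      8 * Real.log (Real.log n) / Real.log n ≤ δ →
      δ ≤ (1 / 3) * (1 - 4 / Real.log n) →
      δ ∉ Set.Ioo (1 / 4 - 3 / (2 * Real.log n)) (1 / 4 + 2 / Real.log n) →
      ∃ ℓ : ℕ, 2 ≤ ℓ ∧
        (1 / (2 * (ℓ : ℝ))) * (1 + 4 * (ℓ : ℝ) / Real.log n) ≤ δ ∧
        δ ≤ (1 / (1 + (ℓ : ℝ))) * (1 - 2 * (ℓ : ℝ) / Real.log n) := by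
  have hlog : Tendsto (fun n : ℕ => Real.log n) atTop atTop :=
    Real.tendsto_log_atTop.comp tendsto_natCast_atTop_atTop
  obtain ⟨N₀, hN⟩ := eventually_atTop.1 ((hlog.eventually_gt_atTop 0).and
    ((Real.tendsto_log_atTop.comp hlog).eventually_ge_atTop 5))
  refine ⟨N₀, fun n hn δ hlow hup hgap => ?_⟩
  obtain ⟨hLpos, hM⟩ := hN n hn
  simp only [Function.comp_apply] at hM
  set L := Real.log n
  have hquot : ∀ a : ℝ, a / L = a * (1 / L) := fun a => by ring
  have hhalf : 3 / (2 * L) = 3 / 2 * (1 / L) := by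
    field_simp
  have hepos : 0 < 1 / L := by positivity
  rw [hquot] at hlow hup
  rw [Set.mem_Ioo, hhalf, hquot 2, not_and_or, not_lt, not_lt] at hgap
  obtain ⟨ℓ, htwo, hlower, hupper⟩ := exists_ell_of_small hepos
    (le_trans (by gcongr; linarith) hlow) hup hgap
  have hℓ : (0 : ℝ) < ℓ := by exact_mod_cast (by omega : 0 < ℓ)
  refine ⟨ℓ, htwo, ?_, ?_⟩
  · convert hlower using 1
    field_simp
    ring
  · rw [one_div_mul_eq_div, le_div_iff₀ (by positivity), hquot]
    exact hupper
end

section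
/- For every integer ℓ ≥ 1 and every real β > 0 with βℓ < 1, one has P_{n,p}(D(A,B) contains at least βn pairwise vertex-disjoint unstable 2ℓ-cycles) ≤ ((eℓ/β) · n^{2ℓ} · p^{2ℓ+2})^{βn}. -/
open MeasureTheory Filter Finset
open scoped ENNReal

noncomputable def entryWeight (p : ℝ) (b : Bool) : ℝ≥0∞ :=
  if b then ENNReal.ofReal p else ENNReal.ofReal (1 - p)

noncomputable def pairWeight (n : ℕ) (p : ℝ)
    (ω : (Fin n → Fin n → Bool) × (Fin n → Fin n → Bool)) : ℝ≥0∞ :=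
  (∏ i : Fin n, ∏ j : Fin n, entryWeight p (ω.1 i j)) *
    (∏ i : Fin n, ∏ j : Fin n, entryWeight p (ω.2 i j))

/-- The i.i.d. Bernoulli(p) measure `P_{n,p}` on pairs of n×n Boolean matrices. -/
noncomputable def gameMeasure (n : ℕ) (p : ℝ) :
    Measure ((Fin n → Fin n → Bool) × (Fin n → Fin n → Bool)) :=
  Measure.sum fun ω => pairWeight n p ω • Measure.dirac ω

/-- D(A,B) contains m pairwise vertex-disjoint 2ℓ-cycles. -/
def HasDisjCycles (ℓ n m : ℕ) (A B : Fin n → Fin n → Bool) : Prop :=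
  ∃ r c : Fin m → ZMod ℓ → Fin n,
    (∀ t, IsCycle ℓ n A B (r t) (c t)) ∧
      ∀ s t, s ≠ t → (∀ k k', r s k ≠ r t k') ∧ ∀ k k', c s k ≠ c t k'

/-- D(A,B) contains m pairwise vertex-disjoint unstable 2ℓ-cycles. -/
def HasDisjUnstableCycles (ℓ n m : ℕ) (A B : Fin n → Fin n → Bool) : Prop :=
  ∃ r c : Fin m → ZMod ℓ → Fin n,
    (∀ t, IsCycle ℓ n A B (r t) (c t) ∧ ¬ IsStableCycle ℓ n A B (r t) (c t)) ∧
      ∀ s t, s ≠ t → (∀ k k', r s k ≠ r t k') ∧ ∀ k k', c s k ≠ c t k'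

/-- Positions in a pair of matrices: `Sum.inl` addresses `A`, `Sum.inr` addresses `B`. -/
abbrev Position (n : ℕ) := (Fin n × Fin n) ⊕ (Fin n × Fin n)

/-- The flattening of a pair of matrices to a single family of entries. -/
def entriesEquiv (n : ℕ) :
    ((Fin n → Fin n → Bool) × (Fin n → Fin n → Bool)) ≃ (Position n → Bool) :=
  ((Equiv.curry _ _ _).symm.prodCongr (Equiv.curry _ _ _).symm).trans
    (Equiv.sumArrowEquivProdArrow _ _ _).symm

@[simp] lemma entriesEquiv_inl {n : ℕ} (ω : (Fin n → Fin n → Bool) × (Fin n → Fin n → Bool))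
    (i j : Fin n) : entriesEquiv n ω (Sum.inl (i, j)) = ω.1 i j := rfl

@[simp] lemma entriesEquiv_inr {n : ℕ} (ω : (Fin n → Fin n → Bool) × (Fin n → Fin n → Bool))
    (i j : Fin n) : entriesEquiv n ω (Sum.inr (i, j)) = ω.2 i j := rfl

lemma pairWeight_eq_prod (n : ℕ) (p : ℝ)
    (ω : (Fin n → Fin n → Bool) × (Fin n → Fin n → Bool)) :
    pairWeight n p ω = ∏ e, entryWeight p (entriesEquiv n ω e) := by
  simp [pairWeight, Fintype.prod_sum_type, Fintype.prod_prod_type]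

/-- The probability that all entries in a prescribed set of positions equal `1`. -/
lemma gameMeasure_forall_eq_true (n : ℕ) {p : ℝ} (hp0 : 0 ≤ p) (hp1 : p ≤ 1)
    (E : Finset (Position n)) :
    gameMeasure n p {ω | ∀ e ∈ E, entriesEquiv n ω e = true} = ENNReal.ofReal p ^ #E := by
  classical
  have hsum : ENNReal.ofReal p + ENNReal.ofReal (1 - p) = 1 := by
    rw [← ENNReal.ofReal_add hp0 (by linarith)]; simp
  let g : Position n → Bool → ℝ≥0∞ := fun e b =>
    entryWeight p b * if e ∈ E → b = true then 1 else 0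
  have hg : ∀ e, ∑ b, g e b = if e ∈ E then ENNReal.ofReal p else 1 := by
    intro e
    by_cases he : e ∈ E <;> simp [g, he, entryWeight, hsum]
  calc gameMeasure n p {ω | ∀ e ∈ E, entriesEquiv n ω e = true}
      = ∑ ω, ∏ e, g e (entriesEquiv n ω e) := by
        rw [gameMeasure, Measure.sum_apply _ (Set.toFinite _).measurableSet, tsum_fintype]
        refine Finset.sum_congr rfl fun ω _ => ?_
        rw [Measure.smul_apply, Measure.dirac_apply, smul_eq_mul, pairWeight_eq_prod,
          Finset.prod_mul_distrib]
        congr 1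
        rw [Finset.prod_ite_zero]
        simp [Set.indicator_apply]
    _ = ∑ f : Position n → Bool, ∏ e, g e (f e) :=
        (entriesEquiv n).sum_comp fun f => ∏ e, g e (f e)
    _ = ∏ e, ∑ b, g e b := by
        rw [Finset.prod_univ_sum, Fintype.piFinset_univ]
    _ = ENNReal.ofReal p ^ #E := by
        rw [Finset.prod_congr rfl fun e _ => hg e, Finset.prod_ite]
        simp

lemma gameMeasure_univ (n : ℕ) {p : ℝ} (hp0 : 0 ≤ p) (hp1 : p ≤ 1) :
    gameMeasure n p Set.univ = 1 := by
  simpa using gameMeasure_forall_eq_true n hp0 hp1 ∅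

/-- A potential unstable cycle, rotated so that one of the two vertices witnessing instability
has index `0`: the rows and columns of the cycle, the index of the second witnessing vertex
(one less than the stored one), and the outside row or column incident with both of them. -/
abbrev CycleWitness (ℓ n : ℕ) :=
  ((ZMod ℓ → Fin n) × (ZMod ℓ → Fin n)) × (Fin (ℓ / 2) × (Fin n ⊕ Fin n))

namespace CycleWitness

variable {ℓ n : ℕ}

/-- The rows of the cycle. -/
def row (x : CycleWitness ℓ n) : ZMod ℓ → Fin n := x.1.1

/-- The columns of the cycle. -/
def col (x : CycleWitness ℓ n) : ZMod ℓ → Fin n := x.1.2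

/-- The index of the second vertex witnessing instability. -/
def offset (x : CycleWitness ℓ n) : ZMod ℓ := ((x.2.1 : ℕ) + 1 : ℕ)

/-- The outside vertex: a row (`Sum.inl`) or a column (`Sum.inr`). -/
def outside (x : CycleWitness ℓ n) : Fin n ⊕ Fin n := x.2.2

/-- The positions which must hold a `1`. -/
def position (x : CycleWitness ℓ n) : (ZMod ℓ ⊕ ZMod ℓ) ⊕ Bool → Position n
  | Sum.inl (Sum.inl k) => Sum.inl (x.row (k + 1), x.col k)
  | Sum.inl (Sum.inr k) => Sum.inr (x.row k, x.col k)
  | Sum.inr b =>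
    x.outside.elim (fun i => Sum.inl (i, x.col (if b then x.offset else 0)))
      (fun j => Sum.inr (x.row (if b then x.offset else 0), j))

/-- The cycle has distinct rows and distinct columns, and the outside vertex is off the cycle. -/
def Admissible (x : CycleWitness ℓ n) : Prop :=
  Function.Injective x.row ∧ Function.Injective x.col ∧
    x.outside.elim (fun i => i ∉ Set.range x.row) (fun j => j ∉ Set.range x.col)

lemma offset_ne_zero (x : CycleWitness ℓ n) : x.offset ≠ 0 := by
  have h := x.2.1.isLt
  rw [offset, Ne, ZMod.natCast_eq_zero_iff]
  exact Nat.not_dvd_of_pos_of_lt (Nat.succ_pos _) (by omega)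

lemma Admissible.position_injective {x : CycleWitness ℓ n} (hx : x.Admissible) :
    Function.Injective x.position := by
  obtain ⟨hr, hc, ho⟩ := hx
  have h0 := x.offset_ne_zero
  have h0' := h0.symm
  cases hw : x.outside with
  | inl i =>
    simp only [hw, Sum.elim_inl, Set.mem_range, not_exists] at ho
    have ho' : ∀ k, i ≠ x.row k := fun k h => ho k h.symm
    rintro ((k | k) | (_ | _)) ((k' | k') | (_ | _)) <;>
      simp_all [position, hr.eq_iff, hc.eq_iff]
  | inr j =>
    simp only [hw, Sum.elim_inr, Set.mem_range, not_exists] at ho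
    have ho' : ∀ k, j ≠ x.col k := fun k h => ho k h.symm
    rintro ((k | k) | (_ | _)) ((k' | k') | (_ | _)) <;>
      simp_all [position, hr.eq_iff, hc.eq_iff]

/-- Every position of a witness lies in `A` in a column of the cycle, or in `B` in a row of it. -/
lemma position_mem (x : CycleWitness ℓ n) (s : (ZMod ℓ ⊕ ZMod ℓ) ⊕ Bool) :
    (x.position s).elim (fun q => q.2 ∈ Set.range x.col) (fun q => q.1 ∈ Set.range x.row) := by
  cases hw : x.outside <;> rcases s with (k | k) | b <;> simp [position, hw]

/-- A family of admissible witnesses on pairwise disjoint cycles. -/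
def DisjAdmissible {m : ℕ} (τ : Fin m → CycleWitness ℓ n) : Prop :=
  (∀ t, (τ t).Admissible) ∧
    ∀ s t, s ≠ t → (∀ k k', (τ s).row k ≠ (τ t).row k') ∧ ∀ k k', (τ s).col k ≠ (τ t).col k'

/-- The family is admissible and all the entries it requires are present in `ω`. -/
def Realized {m : ℕ} (τ : Fin m → CycleWitness ℓ n)
    (ω : (Fin n → Fin n → Bool) × (Fin n → Fin n → Bool)) : Prop :=
  DisjAdmissible τ ∧ ∀ t s, entriesEquiv n ω ((τ t).position s) = true

lemma DisjAdmissible.position_injective {m : ℕ} {τ : Fin m → CycleWitness ℓ n}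
    (hτ : DisjAdmissible τ) :
    Function.Injective fun q : Fin m × ((ZMod ℓ ⊕ ZMod ℓ) ⊕ Bool) => (τ q.1).position q.2 := by
  rintro ⟨t, a⟩ ⟨t', a'⟩ h
  simp only at h
  obtain rfl : t = t' := by
    by_contra hne
    obtain ⟨hr, hc⟩ := hτ.2 t t' hne
    have h1 := (τ t).position_mem a
    have h2 := (τ t').position_mem a'
    rw [← h] at h2
    cases hq : (τ t).position a with
    | inl q =>
      simp only [hq, Sum.elim_inl] at h1 h2
      obtain ⟨k, hk⟩ := h1
      obtain ⟨k', hk'⟩ := h2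
      exact hc k k' (hk.trans hk'.symm)
    | inr q =>
      simp only [hq, Sum.elim_inr] at h1 h2
      obtain ⟨k, hk⟩ := h1
      obtain ⟨k', hk'⟩ := h2
      exact hr k k' (hk.trans hk'.symm)
  rw [(hτ.1 t).position_injective h]

lemma gameMeasure_realized_le [NeZero ℓ] {p : ℝ} (hp0 : 0 ≤ p) (hp1 : p ≤ 1) {m : ℕ}
    (τ : Fin m → CycleWitness ℓ n) :
    gameMeasure n p {ω | Realized τ ω} ≤ ENNReal.ofReal p ^ (m * (2 * ℓ + 2)) := by
  classical
  by_cases hτ : DisjAdmissible τ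
  · let E : Finset (Position n) := Finset.univ.image
      fun q : Fin m × ((ZMod ℓ ⊕ ZMod ℓ) ⊕ Bool) => (τ q.1).position q.2
    have hE : #E = m * (2 * ℓ + 2) := by
      rw [Finset.card_image_of_injective _ hτ.position_injective]
      simp [ZMod.card, two_mul]
    rw [← hE, ← gameMeasure_forall_eq_true n hp0 hp1 E]
    refine measure_mono fun ω hω e he => ?_
    obtain ⟨q, -, rfl⟩ := Finset.mem_image.1 he
    exact hω.2 q.1 q.2
  · simp [Realized, hτ]

lemma Realized.factorial_le_card [NeZero ℓ] {m : ℕ} {τ : Fin m → CycleWitness ℓ n}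
    {ω : (Fin n → Fin n → Bool) × (Fin n → Fin n → Bool)} (hτ : Realized τ ω)
    [DecidablePred fun σ : Fin m → CycleWitness ℓ n => Realized σ ω] :
    m.factorial ≤ #{σ : Fin m → CycleWitness ℓ n | Realized σ ω} := by
  have hinj : Function.Injective τ := by
    intro s t hst
    by_contra hne
    exact (hτ.1.2 s t hne).1 0 0 (by rw [hst])
  have hcard : m.factorial = #(Finset.univ : Finset (Equiv.Perm (Fin m))) := by
    simp [Fintype.card_perm]
  rw [hcard]
  refine Finset.card_le_card_of_injOn (fun π => τ ∘ π) (fun π _ => ?_) fun π _ π' _ h => ?_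
  · simp only [Finset.coe_filter, Finset.mem_univ, true_and, Set.mem_ofPred_eq]
    exact ⟨⟨fun t => hτ.1.1 _, fun s t hst => hτ.1.2 _ _ (π.injective.ne hst)⟩,
      fun t => hτ.2 _⟩
  · exact Equiv.ext fun t => hinj (congrFun h t)

lemma factorial_mul_gameMeasure_le [NeZero ℓ] {p : ℝ} (hp0 : 0 ≤ p) (hp1 : p ≤ 1) (m : ℕ) :
    (m.factorial : ℝ≥0∞) *
        gameMeasure n p {ω | ∃ τ : Fin m → CycleWitness ℓ n, Realized τ ω} ≤
      (Fintype.card (CycleWitness ℓ n) : ℝ≥0∞) ^ m * ENNReal.ofReal p ^ (m * (2 * ℓ + 2)) := by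
  classical
  let F : (Fin n → Fin n → Bool) × (Fin n → Fin n → Bool) → ℝ≥0∞ := fun ω =>
    ∑ τ : Fin m → CycleWitness ℓ n, Set.indicator {ω | Realized τ ω} 1 ω
  have hF : ∀ ω, F ω = #{σ : Fin m → CycleWitness ℓ n | Realized σ ω} := by
    intro ω
    simp [F, Set.indicator_apply]
  calc (m.factorial : ℝ≥0∞) *
        gameMeasure n p {ω | ∃ τ : Fin m → CycleWitness ℓ n, Realized τ ω}
      ≤ m.factorial * gameMeasure n p {ω | (m.factorial : ℝ≥0∞) ≤ F ω} := by
        gcongr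
        rename_i ω
        rintro ⟨τ, hτ⟩
        rw [hF]
        exact_mod_cast hτ.factorial_le_card
    _ ≤ ∫⁻ ω, F ω ∂gameMeasure n p := mul_meas_ge_le_lintegral (Measurable.of_discrete) _
    _ = ∑ τ : Fin m → CycleWitness ℓ n, gameMeasure n p {ω | Realized τ ω} := by
        rw [lintegral_finsetSum _ fun _ _ => Measurable.of_discrete]
        exact Finset.sum_congr rfl fun τ _ =>
          lintegral_indicator_one (Set.toFinite _).measurableSet
    _ ≤ ∑ _τ : Fin m → CycleWitness ℓ n, ENNReal.ofReal p ^ (m * (2 * ℓ + 2)) :=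
        Finset.sum_le_sum fun τ _ => gameMeasure_realized_le hp0 hp1 τ
    _ = _ := by
        rw [Finset.sum_const, nsmul_eq_mul, Finset.card_univ, Fintype.card_fun, Fintype.card_fin]
        push_cast
        rfl

lemma card_le [NeZero ℓ] : Fintype.card (CycleWitness ℓ n) ≤ ℓ * n ^ (2 * ℓ + 1) := by
  have h : Fintype.card (CycleWitness ℓ n) = (ℓ / 2 * 2) * n ^ (2 * ℓ + 1) := by
    simp only [Fintype.card_prod, Fintype.card_sum, Fintype.card_fun, Fintype.card_fin, ZMod.card]
    ring
  rw [h]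
  exact Nat.mul_le_mul_right _ (Nat.div_mul_le_self ℓ 2)

end CycleWitness

lemma ZMod.exists_succ_eq_or_neg {ℓ : ℕ} [NeZero ℓ] {d : ZMod ℓ} (hd : d ≠ 0) :
    ∃ e : Fin (ℓ / 2), (((e : ℕ) + 1 : ℕ) : ZMod ℓ) = d ∨ (((e : ℕ) + 1 : ℕ) : ZMod ℓ) = -d := by
  have hpos : d.val ≠ 0 := by rwa [Ne, ZMod.val_eq_zero]
  have hlt := d.val_lt
  by_cases h : d.val ≤ ℓ / 2
  · exact ⟨⟨d.val - 1, by omega⟩, Or.inl (by simp [Nat.sub_add_cancel (Nat.pos_of_ne_zero hpos)])⟩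
  · have : NeZero d := ⟨hd⟩
    have hval : (-d).val = ℓ - d.val := ZMod.val_neg_of_ne_zero d
    refine ⟨⟨(-d).val - 1, by omega⟩, Or.inr ?_⟩
    simp only
    rw [Nat.sub_add_cancel (by omega), ZMod.natCast_zmod_val]

/-- Two distinct indices become `0` and an offset at most `ℓ / 2` after a rotation. -/
lemma ZMod.exists_rotation {ℓ : ℕ} [NeZero ℓ] {k k' : ZMod ℓ} (h : k ≠ k') (P : ZMod ℓ → Prop)
    (hk : P k) (hk' : P k') :
    ∃ (a : ZMod ℓ) (e : Fin (ℓ / 2)), P a ∧ P ((((e : ℕ) + 1 : ℕ) : ZMod ℓ) + a) := by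
  obtain ⟨e, he | he⟩ := ZMod.exists_succ_eq_or_neg (sub_ne_zero.2 h.symm)
  · exact ⟨k, e, hk, by rw [he]; simpa using hk'⟩
  · exact ⟨k', e, hk', by rw [he]; simpa using hk⟩

lemma IsCycle.exists_witness {ℓ n : ℕ} [NeZero ℓ]
    {ω : (Fin n → Fin n → Bool) × (Fin n → Fin n → Bool)} {r c : ZMod ℓ → Fin n}
    (h : IsCycle ℓ n ω.1 ω.2 r c) (hs : ¬ IsStableCycle ℓ n ω.1 ω.2 r c) :
    ∃ x : CycleWitness ℓ n, x.Admissible ∧ (∀ s, entriesEquiv n ω (x.position s) = true) ∧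
      ∃ a, (∀ k, x.row k = r (k + a)) ∧ ∀ k, x.col k = c (k + a) := by
  obtain ⟨hr, hc, hB, hA⟩ := h
  have key : ∃ (a : ZMod ℓ) (e : Fin (ℓ / 2)) (o : Fin n ⊕ Fin n),
      o.elim (fun i => i ∉ Set.range r ∧ ω.1 i (c a) = true ∧
          ω.1 i (c ((((e : ℕ) + 1 : ℕ) : ZMod ℓ) + a)) = true)
        (fun j => j ∉ Set.range c ∧ ω.2 (r a) j = true ∧
          ω.2 (r ((((e : ℕ) + 1 : ℕ) : ZMod ℓ) + a)) j = true) := by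
    by_contra hno
    refine hs ⟨⟨hr, hc, hB, hA⟩, fun i hi k k' hk hk' => ?_, fun j hj k k' hk hk' => ?_⟩
    · by_contra hne
      obtain ⟨a, e, h1, h2⟩ := ZMod.exists_rotation (fun h => hne (congrArg c h))
        (fun k => ω.1 i (c k) = true) hk hk'
      exact hno ⟨a, e, Sum.inl i, hi, h1, h2⟩
    · by_contra hne
      obtain ⟨a, e, h1, h2⟩ := ZMod.exists_rotation (fun h => hne (congrArg r h))
        (fun k => ω.2 (r k) j = true) hk hk'
      exact hno ⟨a, e, Sum.inr j, hj, h1, h2⟩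
  obtain ⟨a, e, o, ho⟩ := key
  refine ⟨((fun k => r (k + a), fun k => c (k + a)), (e, o)),
    ⟨hr.comp (add_left_injective a), hc.comp (add_left_injective a), ?_⟩, ?_, a,
    fun _ => rfl, fun _ => rfl⟩
  · cases o with
    | inl i => exact fun ⟨k, hk⟩ => ho.1 ⟨_, hk⟩
    | inr j => exact fun ⟨k, hk⟩ => ho.1 ⟨_, hk⟩
  · rintro ((k | k) | b)
    · have := hA (k + a)
      rwa [add_right_comm] at this
    · exact hB (k + a)
    · cases o <;> cases b <;>
        simp_all [CycleWitness.position, CycleWitness.outside, CycleWitness.row,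
          CycleWitness.col, CycleWitness.offset]

lemma HasDisjUnstableCycles.exists_realized {ℓ n m m' : ℕ} [NeZero ℓ] (hm : m ≤ m')
    {ω : (Fin n → Fin n → Bool) × (Fin n → Fin n → Bool)}
    (h : HasDisjUnstableCycles ℓ n m' ω.1 ω.2) :
    ∃ τ : Fin m → CycleWitness ℓ n, CycleWitness.Realized τ ω := by
  obtain ⟨r, c, hu, hd⟩ := h
  choose x hx hpos a hrow hcol using fun t => (hu t).1.exists_witness (hu t).2
  refine ⟨fun t => x (Fin.castLE hm t), ⟨fun t => hx _, fun s t hst => ?_⟩, fun t => hpos _⟩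
  have hd' := hd _ _ ((Fin.castLE_injective hm).ne hst)
  exact ⟨fun k k' => by simpa only [hrow] using hd'.1 _ _,
    fun k k' => by simpa only [hcol] using hd'.2 _ _⟩

lemma pow_div_factorial_le {x y : ℝ} (hx : 0 ≤ x) (hy : 0 < y) {m : ℕ} (hm : y ≤ m) :
    x ^ m / m.factorial ≤ (Real.exp 1 * x / y) ^ m := by
  have h1 : y ^ m / m.factorial ≤ Real.exp 1 ^ m := by
    rw [← Real.exp_nat_mul, mul_one]
    exact le_trans (by gcongr) (Real.pow_div_factorial_le_exp m (Nat.cast_nonneg m) m)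
  have h2 : x ^ m / m.factorial = (x / y) ^ m * (y ^ m / m.factorial) := by
    rw [div_pow]; field_simp
  rw [h2, mul_comm (Real.exp 1), mul_div_right_comm, mul_pow]
  gcongr

theorem disjoint_unstable_cycles_prob (n : ℕ) (hn : 1 ≤ n) (p : ℝ) (hp0 : 0 ≤ p) (hp1 : p ≤ 1)
    (ℓ : ℕ) (hℓ : 1 ≤ ℓ) (β : ℝ) (hβ0 : 0 < β) (hβℓ : β * (ℓ : ℝ) < 1) :
    gameMeasure n p
        {ω | ∃ m : ℕ, β * (n : ℝ) ≤ (m : ℝ) ∧ HasDisjUnstableCycles ℓ n m ω.1 ω.2}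
      ≤ ENNReal.ofReal
          ((Real.exp 1 * (ℓ : ℝ) / β * (n : ℝ) ^ (2 * ℓ) * p ^ (2 * ℓ + 2)) ^ (β * (n : ℝ))) := by
  have : NeZero ℓ := ⟨by omega⟩
  have hn0 : (0 : ℝ) < n := by exact_mod_cast hn
  have hβn : 0 < β * n := by positivity
  set X : ℝ := Real.exp 1 * (ℓ : ℝ) / β * (n : ℝ) ^ (2 * ℓ) * p ^ (2 * ℓ + 2) with hX
  have hX0 : 0 ≤ X := by positivity
  rcases le_total 1 X with h1 | h1
  · calc _ ≤ gameMeasure n p Set.univ := measure_mono (Set.subset_univ _)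
      _ = 1 := gameMeasure_univ n hp0 hp1
      _ ≤ _ := by
        rw [← ENNReal.ofReal_one]
        exact ENNReal.ofReal_le_ofReal (Real.one_le_rpow h1 hβn.le)
  set m := ⌈β * n⌉₊ with hm
  have hmle : β * n ≤ m := Nat.le_ceil _
  set Y : ℝ := ℓ * n ^ (2 * ℓ + 1) * p ^ (2 * ℓ + 2) with hY
  have hXY : Real.exp 1 * Y / (β * n) = X := by
    rw [hX, hY]; field_simp; ring
  have hfac : (m.factorial : ℝ≥0∞) ≠ 0 := by exact_mod_cast m.factorial_ne_zero
  calc _ ≤ gameMeasure n p {ω | ∃ τ : Fin m → CycleWitness ℓ n, CycleWitness.Realized τ ω} :=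
        measure_mono <| by
          rintro ω ⟨m', hm', h⟩
          exact h.exists_realized (Nat.ceil_le.2 hm')
    _ ≤ ENNReal.ofReal (Y ^ m / m.factorial) := by
        rw [ENNReal.ofReal_div_of_pos (by positivity), ENNReal.ofReal_natCast,
          ENNReal.le_div_iff_mul_le (Or.inl hfac) (Or.inl (ENNReal.natCast_ne_top _)), mul_comm]
        refine (CycleWitness.factorial_mul_gameMeasure_le hp0 hp1 m).trans ?_
        rw [mul_comm m, pow_mul, ← mul_pow, ENNReal.ofReal_pow (by positivity), hY,
          ENNReal.ofReal_mul (by positivity), ENNReal.ofReal_pow hp0]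
        gcongr
        rw [← Nat.cast_pow, ← Nat.cast_mul, ENNReal.ofReal_natCast]
        exact_mod_cast CycleWitness.card_le
    _ ≤ ENNReal.ofReal (X ^ (β * n)) := by
        refine ENNReal.ofReal_le_ofReal ?_
        calc Y ^ m / m.factorial ≤ X ^ m := hXY ▸ pow_div_factorial_le (by positivity) hβn hmle
          _ = X ^ (m : ℝ) := (Real.rpow_natCast X m).symm
          _ ≤ X ^ (β * n) := Real.rpow_le_rpow_of_exponent_ge' hX0 h1 hβn.le hmle
end

section
/- Let p : ℕ → [0,1] and ℓ : ℕ → ℕ be sequences with ℓ(n) ≥ 1 for all n and ℓ(n)/√(n·p(n)) → 0 as n → ∞. Then there exists N ∈ ℕ such that for all n ≥ N (writing p = p(n) and ℓ = ℓ(n)): P_{n,p}(D(A,B) contains fewer than n/(2ℓ) pairwise vertex-disjoint 2ℓ-cycles) ≤ (4^n/n)·exp(−(np)^{2ℓ}/(6ℓ·2^{2ℓ})) + (4^n/n)·exp(−n²p/(150 ℓ⁸)). -/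
open MeasureTheory Filter Finset
open scoped ENNReal

section AllTrue

variable {G I : Type*}

/-- The indicator that all the coordinates in `A` are `true`. -/
def allTrue (A : Finset G) (ω : G → Bool) : ℝ :=
  if ∀ g ∈ A, ω g = true then 1 else 0

lemma allTrue_nonneg (A : Finset G) (ω : G → Bool) : 0 ≤ allTrue A ω := by
  unfold allTrue; split_ifs <;> norm_num

lemma allTrue_le_one (A : Finset G) (ω : G → Bool) : allTrue A ω ≤ 1 := by
  unfold allTrue; split_ifs <;> norm_num

lemma allTrue_union [DecidableEq G] (A B : Finset G) (ω : G → Bool) :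
    allTrue (A ∪ B) ω = allTrue A ω * allTrue B ω := by
  unfold allTrue
  by_cases hA : ∀ g ∈ A, ω g = true
  · by_cases hB : ∀ g ∈ B, ω g = true
    · rw [if_pos hA, if_pos hB, if_pos, one_mul]
      exact fun g hg => (Finset.mem_union.1 hg).elim (hA g) (hB g)
    · rw [if_neg hB, if_neg, mul_zero]
      exact fun h => hB fun g hg => h g (Finset.mem_union_right _ hg)
  · rw [if_neg hA, if_neg, zero_mul]
    exact fun h => hA fun g hg => h g (Finset.mem_union_left _ hg)

lemma allTrue_congr {A : Finset G} {ω ω' : G → Bool} (h : ∀ g ∈ A, ω g = ω' g) :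
    allTrue A ω = allTrue A ω' := by
  unfold allTrue
  congr 1
  exact propext (forall₂_congr fun g hg => by rw [h g hg])

lemma allTrue_monotone (A : Finset G) : Monotone (allTrue A) := by
  intro ω ω' h
  unfold allTrue
  split_ifs with h1 h2 h2
  · rfl
  · exact absurd (fun g hg => Bool.eq_true_of_true_le (by simpa [h1 g hg] using h g)) h2
  · norm_num
  · rfl

/-- The indicator that none of the sets `A i`, `i ∈ s`, is entirely `true`. -/
noncomputable def noneTrue (A : I → Finset G) (s : Finset I) (ω : G → Bool) : ℝ :=
  ∏ i ∈ s, (1 - allTrue (A i) ω)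

lemma noneTrue_nonneg (A : I → Finset G) (s : Finset I) (ω : G → Bool) : 0 ≤ noneTrue A s ω :=
  Finset.prod_nonneg fun _ _ => sub_nonneg.2 (allTrue_le_one _ _)

lemma noneTrue_le_one (A : I → Finset G) (s : Finset I) (ω : G → Bool) : noneTrue A s ω ≤ 1 :=
  Finset.prod_le_one (fun _ _ => sub_nonneg.2 (allTrue_le_one _ _))
    fun _ _ => sub_le_self _ (allTrue_nonneg _ _)

lemma noneTrue_antitone (A : I → Finset G) (s : Finset I) : Antitone (noneTrue A s) :=
  fun _ _ h => Finset.prod_le_prod (fun _ _ => sub_nonneg.2 (allTrue_le_one _ _))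
    fun _ _ => sub_le_sub_left (allTrue_monotone _ h) 1

lemma noneTrue_anti_subset [DecidableEq I] (A : I → Finset G) {s t : Finset I} (h : s ⊆ t) (ω : G → Bool) :
    noneTrue A t ω ≤ noneTrue A s ω := by
  unfold noneTrue
  rw [← Finset.prod_sdiff h]
  exact mul_le_of_le_one_left (noneTrue_nonneg A s ω) (noneTrue_le_one A _ ω)

lemma one_sub_sum_le_noneTrue (A : I → Finset G) (s : Finset I) (ω : G → Bool) :
    1 - ∑ i ∈ s, allTrue (A i) ω ≤ noneTrue A s ω := by
  classical
  induction s using Finset.induction_on with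
  | empty => simp [noneTrue]
  | insert i s hi ih =>
    have h : noneTrue A (insert i s) ω = (1 - allTrue (A i) ω) * noneTrue A s ω :=
      Finset.prod_insert hi
    rw [h, Finset.sum_insert hi]
    nlinarith [allTrue_nonneg (A i) ω, noneTrue_le_one A s ω]

end AllTrue

section Bernoulli

variable {G : Type*} [Fintype G] [DecidableEq G]

/-- The Bernoulli product weight of a configuration. -/
noncomputable def bernoulliWeight (p : ℝ) (ω : G → Bool) : ℝ :=
  ∏ g, if ω g then p else 1 - p

/-- Expectation under the Bernoulli product weight. -/
noncomputable def bernoulliExp (p : ℝ) (f : (G → Bool) → ℝ) : ℝ :=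
  ∑ ω, bernoulliWeight p ω * f ω

omit [DecidableEq G] in
lemma bernoulliWeight_nonneg {p : ℝ} (h0 : 0 ≤ p) (h1 : p ≤ 1) (ω : G → Bool) :
    0 ≤ bernoulliWeight p ω := by
  refine Finset.prod_nonneg fun g _ => ?_
  split_ifs <;> linarith

lemma sum_bernoulliWeight (p : ℝ) : ∑ ω : G → Bool, bernoulliWeight p ω = 1 := by
  unfold bernoulliWeight
  rw [← Fintype.prod_sum (f := fun (_ : G) (b : Bool) => if b then p else 1 - p)]
  simp

lemma bernoulliExp_const (p c : ℝ) : bernoulliExp p (fun _ : G → Bool => c) = c := by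
  unfold bernoulliExp
  rw [← Finset.sum_mul, sum_bernoulliWeight, one_mul]

lemma bernoulliExp_mono {p : ℝ} (h0 : 0 ≤ p) (h1 : p ≤ 1) {f g : (G → Bool) → ℝ}
    (h : ∀ ω, f ω ≤ g ω) : bernoulliExp p f ≤ bernoulliExp p g :=
  Finset.sum_le_sum fun ω _ => mul_le_mul_of_nonneg_left (h ω) (bernoulliWeight_nonneg h0 h1 ω)

lemma bernoulliExp_sub (p : ℝ) (f g : (G → Bool) → ℝ) :
    bernoulliExp p (fun ω => f ω - g ω) = bernoulliExp p f - bernoulliExp p g := by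
  simp only [bernoulliExp, mul_sub, Finset.sum_sub_distrib]

lemma bernoulliExp_sum {ι : Type*} (s : Finset ι) (p : ℝ) (f : ι → (G → Bool) → ℝ) :
    bernoulliExp p (fun ω => ∑ i ∈ s, f i ω) = ∑ i ∈ s, bernoulliExp p (f i) := by
  simp only [bernoulliExp, Finset.mul_sum]
  exact Finset.sum_comm

lemma bernoulliExp_const_mul (p c : ℝ) (f : (G → Bool) → ℝ) :
    bernoulliExp p (fun ω => c * f ω) = c * bernoulliExp p f := by
  simp only [bernoulliExp, Finset.mul_sum]
  exact Finset.sum_congr rfl fun ω _ => by ring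

/-- A single coordinate is independent of the remaining ones. -/
lemma bernoulliExp_coord_mul (p : ℝ) (a : G) (f : (G → Bool) → ℝ)
    (hf : ∀ ω b, f (Function.update ω a b) = f ω) :
    bernoulliExp p (fun ω => (if ω a then 1 else 0) * f ω) = p * bernoulliExp p f := by
  have key : ∀ F : Bool → ℝ, bernoulliExp p (fun ω => F (ω a) * f ω) =
      (p * F true + (1 - p) * F false) *
        ∑ τ : {g // g ≠ a} → Bool, (∏ g, if τ g then p else 1 - p) *
          f ((Equiv.funSplitAt a Bool).symm (true, τ)) := by
    intro F
    unfold bernoulliExp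
    rw [← (Equiv.funSplitAt a Bool).symm.sum_comp, Fintype.sum_prod_type, Finset.mul_sum,
      Finset.sum_comm]
    refine Finset.sum_congr rfl fun τ _ => ?_
    have hw : ∀ b, bernoulliWeight p ((Equiv.funSplitAt a Bool).symm (b, τ)) =
        (if b then p else 1 - p) * ∏ g, if τ g then p else 1 - p := by
      intro b
      unfold bernoulliWeight
      rw [Fintype.prod_eq_mul_prod_subtype_ne _ a]
      congr 1
      · simp [Equiv.funSplitAt, Equiv.piSplitAt]
      · refine Finset.prod_congr rfl fun g _ => ?_
        simp [Equiv.funSplitAt, Equiv.piSplitAt, g.2]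
    have hb : f ((Equiv.funSplitAt a Bool).symm (false, τ)) =
        f ((Equiv.funSplitAt a Bool).symm (true, τ)) := by
      rw [← hf ((Equiv.funSplitAt a Bool).symm (true, τ)) false]
      congr 1
      ext g
      by_cases h : g = a
      · rw [h]; simp [Equiv.funSplitAt, Equiv.piSplitAt]
      · simp [Equiv.funSplitAt, Equiv.piSplitAt, h]
    have hc : ∀ b, (Equiv.funSplitAt a Bool).symm (b, τ) a = b := by
      intro b; simp [Equiv.funSplitAt, Equiv.piSplitAt]
    rw [Fintype.sum_bool]
    simp only [hw, hc, hb, if_true, Bool.false_eq_true, if_false]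
    ring
  have h1 := key fun b => if b then 1 else 0
  have h2 := key fun _ => 1
  simp only [one_mul] at h2
  rw [h1, h2]
  simp

lemma bernoulliExp_allTrue_mul (p : ℝ) (A : Finset G) (f : (G → Bool) → ℝ)
    (hf : ∀ a ∈ A, ∀ ω b, f (Function.update ω a b) = f ω) :
    bernoulliExp p (fun ω => allTrue A ω * f ω) = p ^ A.card * bernoulliExp p f := by
  induction A using Finset.induction_on with
  | empty => simp [allTrue]
  | insert a A ha ih =>
    have h1 : ∀ ω, allTrue (insert a A) ω * f ω =
        (if ω a then 1 else 0) * (allTrue A ω * f ω) := by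
      intro ω
      rw [Finset.insert_eq, allTrue_union, mul_assoc]
      simp [allTrue]
    simp only [h1]
    rw [bernoulliExp_coord_mul, ih fun b hb => hf b (Finset.mem_insert_of_mem hb),
      Finset.card_insert_of_notMem ha, pow_succ]
    · ring
    · intro ω b
      rw [hf a (Finset.mem_insert_self a A)]
      congr 1
      exact allTrue_congr fun g hg => Function.update_of_ne (ne_of_mem_of_not_mem hg ha) _ _

lemma bernoulliExp_allTrue (p : ℝ) (A : Finset G) :
    bernoulliExp p (allTrue A) = p ^ A.card := by
  have := bernoulliExp_allTrue_mul p A (fun _ => 1) (fun _ _ _ _ => rfl)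
  simpa [bernoulliExp_const] using this

/-- Harris' inequality: increasing and decreasing functions are negatively correlated. -/
lemma bernoulliExp_mul_le {p : ℝ} (h0 : 0 ≤ p) (h1 : p ≤ 1) {f g : (G → Bool) → ℝ}
    (hf0 : ∀ ω, 0 ≤ f ω) (hf : Monotone f) (hg1 : ∀ ω, g ω ≤ 1) (hg : Antitone g) :
    bernoulliExp p (fun ω => f ω * g ω) ≤ bernoulliExp p f * bernoulliExp p g := by
  have h := fkg (μ := bernoulliWeight p) (f := f) (g := fun ω => 1 - g ω)
    (fun ω => bernoulliWeight_nonneg h0 h1 ω) hf0 (fun ω => sub_nonneg.2 (hg1 ω)) hf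
    (fun ω ω' h => sub_le_sub_left (hg h) 1) (fun a b => by
      unfold bernoulliWeight
      rw [← Finset.prod_mul_distrib, ← Finset.prod_mul_distrib]
      refine le_of_eq (Finset.prod_congr rfl fun g _ => ?_)
      simp only [Pi.inf_apply, Pi.sup_apply]
      rcases Bool.eq_false_or_eq_true (a g) with ha | ha <;>
        rcases Bool.eq_false_or_eq_true (b g) with hb | hb <;> simp [ha, hb, mul_comm])
  rw [sum_bernoulliWeight, one_mul] at h
  have e1 : ∑ a, bernoulliWeight p a * (1 - g a) = 1 - bernoulliExp p g := by
    simp only [mul_sub, Finset.sum_sub_distrib, mul_one, sum_bernoulliWeight, bernoulliExp]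
  have e2 : ∑ a, bernoulliWeight p a * (f a * (1 - g a)) =
      bernoulliExp p f - bernoulliExp p (fun ω => f ω * g ω) := by
    rw [← bernoulliExp_sub]
    exact Finset.sum_congr rfl fun ω _ => by ring
  rw [e1, e2] at h
  change bernoulliExp p f * _ ≤ _ at h
  linarith

end Bernoulli

section Janson

variable {G : Type*} [Fintype G] [DecidableEq G] {I : Type*} [DecidableEq I]

lemma noneTrue_insert_le {p : ℝ} (h0 : 0 ≤ p) (h1 : p ≤ 1) (A : I → Finset G) {i : I}
    {s : Finset I} (hi : i ∉ s) :
    bernoulliExp p (noneTrue A (insert i s)) ≤ bernoulliExp p (noneTrue A s) *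
      Real.exp (-p ^ (A i).card +
        ∑ j ∈ s with ¬ Disjoint (A i) (A j), p ^ (A i ∪ A j).card) := by
  set T := s.filter fun j => ¬ Disjoint (A i) (A j) with hT
  set U := s.filter fun j => Disjoint (A i) (A j) with hU
  set d := p ^ (A i).card - ∑ j ∈ T, p ^ (A i ∪ A j).card with hd
  have hE0 : ∀ t, 0 ≤ bernoulliExp p (noneTrue A t) := fun t =>
    Finset.sum_nonneg fun ω _ =>
      mul_nonneg (bernoulliWeight_nonneg h0 h1 ω) (noneTrue_nonneg A t ω)
  have hsplit : ∀ ω, noneTrue A s ω = noneTrue A U ω * noneTrue A T ω := fun ω =>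
    (Finset.prod_filter_mul_prod_filter_not s (fun j => Disjoint (A i) (A j)) _).symm
  have hins : ∀ ω, noneTrue A (insert i s) ω =
      noneTrue A s ω - allTrue (A i) ω * noneTrue A s ω := by
    intro ω
    simp only [noneTrue, Finset.prod_insert hi]
    ring
  have hexp : -p ^ (A i).card + ∑ j ∈ T, p ^ (A i ∪ A j).card = -d := by rw [hd]; ring
  rw [hexp]
  rcases le_total d 0 with hneg | hpos
  · calc bernoulliExp p (noneTrue A (insert i s)) ≤ bernoulliExp p (noneTrue A s) :=
          bernoulliExp_mono h0 h1 fun ω => noneTrue_anti_subset A (Finset.subset_insert i s) ω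
      _ ≤ _ := le_mul_of_one_le_right (hE0 s) (Real.one_le_exp (by linarith))
  have hlow : d * bernoulliExp p (noneTrue A U) ≤
      bernoulliExp p (fun ω => allTrue (A i) ω * noneTrue A s ω) := by
    have hpt : ∀ ω, allTrue (A i) ω * noneTrue A U ω -
        ∑ j ∈ T, allTrue (A i ∪ A j) ω * noneTrue A U ω ≤
        allTrue (A i) ω * noneTrue A s ω := by
      intro ω
      have h := mul_le_mul_of_nonneg_left (one_sub_sum_le_noneTrue A T ω)
        (mul_nonneg (allTrue_nonneg (A i) ω) (noneTrue_nonneg A U ω))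
      rw [hsplit]
      simp only [allTrue_union]
      calc _ = allTrue (A i) ω * noneTrue A U ω * (1 - ∑ j ∈ T, allTrue (A j) ω) := by
            rw [mul_sub, mul_one, Finset.mul_sum]
            congr 1
            exact Finset.sum_congr rfl fun j _ => by ring
        _ ≤ _ := by linarith
    refine le_trans ?_ (bernoulliExp_mono h0 h1 hpt)
    rw [bernoulliExp_sub, bernoulliExp_sum, bernoulliExp_allTrue_mul, hd, sub_mul, Finset.sum_mul]
    · refine sub_le_sub_left (Finset.sum_le_sum fun j _ => ?_) _
      refine (bernoulliExp_mul_le h0 h1 (allTrue_nonneg _) (allTrue_monotone _)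
        (noneTrue_le_one A U) (noneTrue_antitone A U)).trans_eq ?_
      rw [bernoulliExp_allTrue]
    · intro a ha ω b
      refine Finset.prod_congr rfl fun j hj => ?_
      congr 1
      refine allTrue_congr fun g hg => Function.update_of_ne ?_ _ _
      rintro rfl
      exact Finset.disjoint_left.1 (Finset.mem_filter.1 hj).2 ha hg
  have hUs : bernoulliExp p (noneTrue A s) ≤ bernoulliExp p (noneTrue A U) :=
    bernoulliExp_mono h0 h1 fun ω => noneTrue_anti_subset A (Finset.filter_subset _ _) ω
  calc bernoulliExp p (noneTrue A (insert i s))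
      = bernoulliExp p (noneTrue A s) -
          bernoulliExp p (fun ω => allTrue (A i) ω * noneTrue A s ω) := by
        rw [← bernoulliExp_sub]
        exact congrArg _ (funext hins)
    _ ≤ bernoulliExp p (noneTrue A s) * (1 - d) := by
        have := mul_le_mul_of_nonneg_left hUs hpos
        linarith
    _ ≤ _ := mul_le_mul_of_nonneg_left (Real.one_sub_le_exp_neg d) (hE0 s)

/-- The Janson inequality. -/
theorem janson {p : ℝ} (h0 : 0 ≤ p) (h1 : p ≤ 1) (A : I → Finset G) (s : Finset I) :
    bernoulliExp p (noneTrue A s) ≤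
      Real.exp (-∑ i ∈ s, p ^ (A i).card + (1 / 2) * ∑ i ∈ s, ∑ j ∈ s,
        if i ≠ j ∧ ¬ Disjoint (A i) (A j) then p ^ (A i ∪ A j).card else 0) := by
  induction s using Finset.induction_on with
  | empty => simp [bernoulliExp_const, show noneTrue A ∅ = fun _ => 1 from rfl]
  | insert i s hi ih =>
    refine (noneTrue_insert_le h0 h1 A hi).trans
      ((mul_le_mul_of_nonneg_right ih (Real.exp_pos _).le).trans_eq ?_)
    rw [← Real.exp_add]
    congr 1
    simp only [Finset.sum_insert hi, Finset.sum_add_distrib]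
    have e1 : ∑ j ∈ s, (if i ≠ j ∧ ¬ Disjoint (A i) (A j) then p ^ (A i ∪ A j).card else 0) =
        ∑ j ∈ s with ¬ Disjoint (A i) (A j), p ^ (A i ∪ A j).card := by
      rw [Finset.sum_filter]
      refine Finset.sum_congr rfl fun j hj => ?_
      simp [(ne_of_mem_of_not_mem hj hi).symm]
    have e2 : ∑ j ∈ s, (if j ≠ i ∧ ¬ Disjoint (A j) (A i) then p ^ (A j ∪ A i).card else 0) =
        ∑ j ∈ s with ¬ Disjoint (A i) (A j), p ^ (A i ∪ A j).card := by
      rw [← e1]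
      exact Finset.sum_congr rfl fun j _ => by
        simp only [Finset.union_comm (A j), ne_comm (a := j), disjoint_comm (a := A j)]
    rw [e1, e2]
    simp only [ne_eq, not_true_eq_false, false_and, if_false, zero_add]
    ring

/-- The Janson inequality after sparsifying the family with density `1 / X`. -/
theorem janson_sparsified [Fintype I] {p : ℝ} (h0 : 0 ≤ p) (h1 : p ≤ 1) (A : I → Finset G)
    {X : ℝ} (hX : 1 ≤ X)
    (hΔ : (∑ i, ∑ j, if ¬ Disjoint (A i) (A j) then p ^ (A i ∪ A j).card else 0) ≤
      X * ∑ i, p ^ (A i).card) :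
    bernoulliExp p (noneTrue A univ) ≤ Real.exp (-(∑ i, p ^ (A i).card) / (2 * X)) := by
  have hX0 : 0 < X := by linarith
  have q0 : 0 ≤ 1 / X := by positivity
  have q1 : 1 / X ≤ 1 := by rw [div_le_one hX0]; exact hX
  set c : I → I → ℝ := fun i j =>
    if i ≠ j ∧ ¬ Disjoint (A i) (A j) then p ^ (A i ∪ A j).card else 0 with hc
  have hc0 : ∀ i j, 0 ≤ c i j := fun i j => by
    simp only [hc]; split_ifs <;> positivity
  set Φ : (I → Bool) → ℝ := fun τ => -∑ i, allTrue {i} τ * p ^ (A i).card +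
    (1 / 2) * ∑ i, ∑ j, allTrue {i, j} τ * c i j with hΦ
  have hbound : ∀ τ : I → Bool, bernoulliExp p (noneTrue A univ) ≤ Real.exp (Φ τ) := by
    intro τ
    refine (bernoulliExp_mono h0 h1
      (noneTrue_anti_subset A (Finset.subset_univ (univ.filter fun i => τ i = true)))).trans
      ((janson h0 h1 A (univ.filter fun i => τ i = true)).trans_eq ?_)
    congr 1
    simp only [hΦ, Finset.sum_filter]
    congr 1
    · congr 1
      exact Finset.sum_congr rfl fun i _ => by simp [allTrue]
    · congr 1
      refine Finset.sum_congr rfl fun i _ => ?_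
      by_cases hi : τ i = true
      · rw [if_pos hi]
        refine Finset.sum_congr rfl fun j _ => ?_
        by_cases hj : τ j = true <;> simp [allTrue, hi, hj, hc]
      · rw [if_neg hi]
        symm
        refine Finset.sum_eq_zero fun j _ => ?_
        simp [allTrue, hi]
  have hmean : bernoulliExp (1 / X) Φ ≤ -(∑ i, p ^ (A i).card) / (2 * X) := by
    have e : bernoulliExp (1 / X) Φ = -((1 / X) * ∑ i, p ^ (A i).card) +
        (1 / 2) * ∑ i, ∑ j, (1 / X) ^ 2 * c i j := by
      have hE : Φ = fun τ => (1 / 2) * (∑ i, ∑ j, c i j * allTrue {i, j} τ) -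
          ∑ i, p ^ (A i).card * allTrue {i} τ := by
        funext τ
        simp only [hΦ, mul_comm (allTrue _ τ)]
        ring
      rw [hE, bernoulliExp_sub, bernoulliExp_const_mul, bernoulliExp_sum, bernoulliExp_sum]
      simp only [bernoulliExp_sum, bernoulliExp_const_mul, bernoulliExp_allTrue]
      have h2 : ∀ i j, c i j * (1 / X) ^ (({i, j} : Finset I)).card = (1 / X) ^ 2 * c i j := by
        intro i j
        by_cases hij : i = j
        · simp [hc, hij]
        · rw [Finset.card_pair hij, mul_comm]
      simp only [h2, Finset.card_singleton, pow_one, Finset.mul_sum]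
      rw [sub_eq_neg_add]
      congr 2
      exact Finset.sum_congr rfl fun i _ => mul_comm _ _
    have hcs : ∑ i, ∑ j, c i j ≤ X * ∑ i, p ^ (A i).card := by
      refine le_trans (Finset.sum_le_sum fun i _ => Finset.sum_le_sum fun j _ => ?_) hΔ
      simp only [hc]
      by_cases hij : i ≠ j <;> by_cases hd : Disjoint (A i) (A j) <;> simp [hij, hd]
      positivity
    rw [e]
    simp only [← Finset.mul_sum]
    have hx2 : (1 / X) ^ 2 * ∑ i, ∑ j, c i j ≤ (1 / X) * ∑ i, p ^ (A i).card := by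
      calc _ ≤ (1 / X) ^ 2 * (X * ∑ i, p ^ (A i).card) := by gcongr
        _ = _ := by field_simp
    calc _ ≤ -((1 / X) * ∑ i, p ^ (A i).card) + (1 / 2) * ((1 / X) * ∑ i, p ^ (A i).card) := by
          gcongr
      _ = _ := by field_simp; ring
  obtain ⟨τ, hτ⟩ : ∃ τ, Φ τ ≤ -(∑ i, p ^ (A i).card) / (2 * X) := by
    by_contra! hcon
    have hlt : ∃ τ : I → Bool, 0 < bernoulliWeight (1 / X) τ := by
      by_contra! hle
      have := sum_bernoulliWeight (G := I) (1 / X)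
      linarith [Finset.sum_nonpos fun τ (_ : τ ∈ univ) => hle τ]
    obtain ⟨τ₀, h₀⟩ := hlt
    have : bernoulliExp (1 / X) (fun _ : I → Bool => -(∑ i, p ^ (A i).card) / (2 * X)) <
        bernoulliExp (1 / X) Φ :=
      Finset.sum_lt_sum (fun τ _ => mul_le_mul_of_nonneg_left (hcon τ).le
        (bernoulliWeight_nonneg q0 q1 τ)) ⟨τ₀, Finset.mem_univ _,
          mul_lt_mul_of_pos_left (hcon τ₀) h₀⟩
    rw [bernoulliExp_const] at this
    linarith
  exact (hbound τ).trans (Real.exp_le_exp.2 hτ)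

end Janson

section Walks

variable {V : Type*} [Fintype V]

/-- Transfer-matrix bound on the total weight of the walks with `L` steps. -/
lemma sum_walk_le {L : ℕ} (g : Fin L → V → V → ℝ) (a : V → ℝ) (K : Fin L → ℝ)
    (ha : ∀ x, 0 ≤ a x) (hg : ∀ k x y, 0 ≤ g k x y) (hK : ∀ k, 0 ≤ K k)
    (hrow : ∀ k x, ∑ y, g k x y ≤ K k) :
    ∑ v : Fin (L + 1) → V, a (v 0) * ∏ k : Fin L, g k (v k.castSucc) (v k.succ) ≤
      (∑ x, a x) * ∏ k, K k := by
  induction L generalizing a with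
  | zero =>
    rw [← (Equiv.funUnique (Fin 1) V).symm.sum_comp]
    simp
  | succ L ih =>
    have hcons : ∑ v : Fin (L + 2) → V, a (v 0) * ∏ k, g k (v k.castSucc) (v k.succ) =
        ∑ v : Fin (L + 1) → V, (∑ x, a x * g 0 x (v 0)) *
          ∏ k : Fin L, g k.succ (v k.castSucc) (v k.succ) := by
      rw [← (Fin.consEquiv fun _ => V).sum_comp, Fintype.sum_prod_type, Finset.sum_comm]
      refine Finset.sum_congr rfl fun v _ => ?_
      rw [Finset.sum_mul]
      refine Finset.sum_congr rfl fun x _ => ?_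
      rw [Fin.prod_univ_succ]
      simp [Fin.consEquiv, mul_assoc]
    rw [hcons, Fin.prod_univ_succ, ← mul_assoc]
    refine (ih (fun k => g k.succ) (fun y => ∑ x, a x * g 0 x y) (fun k => K k.succ)
      (fun y => Finset.sum_nonneg fun x _ => mul_nonneg (ha x) (hg 0 x y))
      (fun k => hg k.succ) (fun k => hK k.succ) fun k => hrow k.succ).trans ?_
    refine mul_le_mul_of_nonneg_right ?_ (Finset.prod_nonneg fun k _ => hK k.succ)
    rw [Finset.sum_comm, Finset.sum_mul]
    refine Finset.sum_le_sum fun x _ => ?_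
    rw [← Finset.mul_sum]
    exact mul_le_mul_of_nonneg_left (hrow 0 x) (ha x)

variable [DecidableEq V] {n : ℕ}

/-- The arc at position `j` of a closed walk `v` whose positions carry types `par`. -/
def arcAt (par : Fin (n + 2) → Bool) (v : Fin (n + 2) → V) (j : Fin (n + 2)) : Bool × V × V :=
  (par j, v j, v (j + 1))

/-- The set of arcs of a closed walk. -/
def arcSet (par : Fin (n + 2) → Bool) (v : Fin (n + 2) → V) : Finset (Bool × V × V) :=
  univ.image (arcAt par v)

/-- A set of typed arcs with out-degrees at most one and at most `ℓ` tails of each type. -/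
structure IsFunctionalArcs (S : Finset (Bool × V × V)) (ℓ : ℕ) : Prop where
  outdeg : ∀ b x, (univ.filter fun y => (b, x, y) ∈ S).card ≤ 1
  tails : ∀ b, (univ.filter fun x => ∃ y, (b, x, y) ∈ S).card ≤ ℓ

lemma isFunctionalArcs_arcSet {par : Fin (n + 2) → Bool} {v : Fin (n + 2) → V} {ℓ : ℕ}
    (hv : Function.Injective fun j => (par j, v j))
    (hℓ : ∀ b, (univ.filter fun j => par j = b).card ≤ ℓ) :
    IsFunctionalArcs (arcSet par v) ℓ where
  outdeg b x := by
    rw [Finset.card_le_one]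
    intro y hy z hz
    simp only [Finset.mem_filter, Finset.mem_univ, true_and, arcSet, Finset.mem_image,
      arcAt, Prod.mk.injEq] at hy hz
    obtain ⟨j, h1, h2, rfl⟩ := hy
    obtain ⟨k, h3, h4, rfl⟩ := hz
    have : j = k := hv (by simp [h1, h2, h3, h4])
    rw [this]
  tails b := by
    refine le_trans (Finset.card_le_card (t := (univ.filter fun j => par j = b).image v) ?_)
      (Finset.card_image_le.trans (hℓ b))
    intro x hx
    simp only [Finset.mem_filter, Finset.mem_univ, true_and, arcSet, Finset.mem_image,
      arcAt, Prod.mk.injEq] at hx ⊢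
    obtain ⟨y, j, h1, h2, -⟩ := hx
    exact ⟨j, h1, h2⟩

variable {S : Finset (Bool × V × V)} {ℓ : ℕ}

lemma IsFunctionalArcs.sum_tails_le (hS : IsFunctionalArcs S ℓ) (b : Bool) :
    ∑ x, (if ∃ y, (b, x, y) ∈ S then (1 : ℝ) else 0) ≤ ℓ := by
  rw [Finset.sum_boole]
  exact_mod_cast hS.tails b

lemma IsFunctionalArcs.sum_outdeg_le (hS : IsFunctionalArcs S ℓ) (b : Bool) (x : V) :
    ∑ y, (if (b, x, y) ∈ S then (1 : ℝ) else 0) ≤ 1 := by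
  rw [Finset.sum_boole]
  exact_mod_cast hS.outdeg b x

lemma IsFunctionalArcs.sum_weight_le (hS : IsFunctionalArcs S ℓ) {p : ℝ} (h0 : 0 ≤ p)
    (b : Bool) (x : V) :
    ∑ y, (if (b, x, y) ∈ S then 1 else p) ≤ Fintype.card V * p + 1 := by
  calc ∑ y, (if (b, x, y) ∈ S then 1 else p)
      ≤ ∑ y, (p + if (b, x, y) ∈ S then 1 else 0) := by
        refine Finset.sum_le_sum fun y _ => ?_
        split_ifs <;> linarith
    _ ≤ _ := by
        rw [Finset.sum_add_distrib, Finset.sum_const, Finset.card_univ, nsmul_eq_mul]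
        exact add_le_add_right (hS.sum_outdeg_le b x) _

/-- The number of closed walks all of whose arcs lie in `S`. -/
lemma IsFunctionalArcs.sum_all_mem_le (hS : IsFunctionalArcs S ℓ) (par : Fin (n + 2) → Bool) :
    ∑ v, (if ∀ j, arcAt par v j ∈ S then (1 : ℝ) else 0) ≤ ℓ := by
  set a : V → ℝ := fun x => if ∃ y, (par 0, x, y) ∈ S then 1 else 0 with ha
  set g : Fin (n + 1) → V → V → ℝ := fun k x y => if (par k.castSucc, x, y) ∈ S then 1 else 0
    with hg
  have h := sum_walk_le g a (fun _ => 1) (fun x => by simp only [ha]; split_ifs <;> norm_num)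
    (fun k x y => by simp only [hg]; split_ifs <;> norm_num) (fun _ => zero_le_one)
    fun k x => hS.sum_outdeg_le _ x
  rw [Finset.prod_const_one, mul_one] at h
  refine le_trans (Finset.sum_le_sum fun v _ => ?_) (h.trans (hS.sum_tails_le (par 0)))
  split_ifs with hv
  · have h1 : a (v 0) = 1 := if_pos ⟨_, hv 0⟩
    have h2 : ∀ k : Fin (n + 1), g k (v k.castSucc) (v k.succ) = 1 := fun k => by
      have := hv k.castSucc
      rw [arcAt, Fin.coeSucc_eq_succ] at this
      exact if_pos this
    simp [h1, h2]
  · refine mul_nonneg ?_ (Finset.prod_nonneg fun k _ => ?_)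
    · simp only [ha]; split_ifs <;> norm_num
    · simp only [hg]; split_ifs <;> norm_num

/-- The weight of the closed walks that enter `S` at position `0`. -/
lemma IsFunctionalArcs.sum_enter_zero_le (hS : IsFunctionalArcs S ℓ) {p : ℝ} (h0 : 0 ≤ p)
    (par : Fin (n + 2) → Bool) :
    ∑ v, (if arcAt par v 0 ∈ S ∧ arcAt par v (Fin.last _) ∉ S then
        ∏ j, (if arcAt par v j ∈ S then 1 else p) else 0) ≤
      p * (ℓ * (Fintype.card V * p + 1) ^ n) := by
  set a : V → ℝ := fun x => if ∃ y, (par 0, x, y) ∈ S then 1 else 0 with ha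
  set g : Fin (n + 1) → V → V → ℝ := fun k x y => if (par k.castSucc, x, y) ∈ S then 1 else
    if k = 0 then 0 else p with hg
  have ha0 : ∀ x, 0 ≤ a x := fun x => by simp only [ha]; split_ifs <;> norm_num
  have hg0 : ∀ k x y, 0 ≤ g k x y := fun k x y => by
    simp only [hg]; split_ifs <;> first | exact h0 | norm_num
  have h := sum_walk_le g a (fun k => if k = 0 then 1 else Fintype.card V * p + 1) ha0 hg0
    (fun k => by split_ifs <;> positivity)
    (fun k x => by
      by_cases hk : k = 0
      · simp only [hg, hk, if_true]
        exact hS.sum_outdeg_le _ x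
      · simp only [hg, hk, if_false]
        exact hS.sum_weight_le h0 _ x)
  rw [Fin.prod_univ_succ] at h
  simp only [Fin.succ_ne_zero, if_true, if_false, one_mul, Finset.prod_const, Finset.card_univ,
    Fintype.card_fin] at h
  have h' := h.trans (mul_le_mul_of_nonneg_right (hS.sum_tails_le (par 0)) (by positivity))
  refine le_trans ?_ (mul_le_mul_of_nonneg_left h' h0)
  rw [Finset.mul_sum]
  refine Finset.sum_le_sum fun v _ => ?_
  split_ifs with hv
  · have h1 : a (v 0) = 1 := if_pos ⟨_, hv.1⟩
    rw [Fin.prod_univ_castSucc, if_neg hv.2, h1, one_mul, mul_comm]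
    refine mul_le_mul_of_nonneg_left (Finset.prod_le_prod
      (fun k _ => by split_ifs <;> first | exact h0 | norm_num) fun k _ => ?_) h0
    by_cases hk : k = 0
    · subst hk
      have h2 := hv.1
      rw [← Fin.castSucc_zero (n := n + 1)] at h2
      rw [if_pos h2]
      rw [arcAt, Fin.coeSucc_eq_succ] at h2
      simp only [hg, if_pos h2, le_refl]
    · simp only [hg, hk, if_false, arcAt, Fin.coeSucc_eq_succ, le_refl]
  · exact mul_nonneg h0 (mul_nonneg (ha0 _) (Finset.prod_nonneg fun k _ => hg0 _ _ _))

/-- The weight of the closed walks that enter `S` at position `i`. -/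
lemma IsFunctionalArcs.sum_enter_le (hS : IsFunctionalArcs S ℓ) {p : ℝ} (h0 : 0 ≤ p)
    (par : Fin (n + 2) → Bool) (i : Fin (n + 2)) :
    ∑ v, (if arcAt par v i ∈ S ∧ arcAt par v (i - 1) ∉ S then
        ∏ j, (if arcAt par v j ∈ S then 1 else p) else 0) ≤
      p * (ℓ * (Fintype.card V * p + 1) ^ n) := by
  refine le_trans (le_of_eq ?_) (hS.sum_enter_zero_le h0 fun k => par (i + k))
  refine Fintype.sum_equiv (Equiv.arrowCongr (Equiv.subRight i) (Equiv.refl V)) _ _ fun v => ?_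
  have e : ∀ k, arcAt (fun k => par (i + k))
      (Equiv.arrowCongr (Equiv.subRight i) (Equiv.refl V) v) k = arcAt par v (i + k) := by
    intro k
    simp [arcAt, add_comm i, add_assoc]
  simp only [e, add_zero]
  have hl : i + Fin.last (n + 1) = i - 1 := by
    rw [sub_eq_add_neg]
    congr 1
    rw [eq_neg_iff_add_eq_zero]
    exact Fin.last_add_one _
  rw [hl, ← Equiv.prod_comp (Equiv.addLeft i) fun j => if arcAt par v j ∈ S then 1 else p]
  simp only [Equiv.coe_addLeft]
  rfl

omit [Fintype V] in
open Fin.CommRing in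
/-- A closed walk meeting `S` either stays in `S` or enters `S` somewhere. -/
lemma all_mem_or_enter {par : Fin (n + 2) → Bool} {v : Fin (n + 2) → V}
    (h : ¬ Disjoint S (arcSet par v)) :
    (∀ j, arcAt par v j ∈ S) ∨ ∃ i, arcAt par v i ∈ S ∧ arcAt par v (i - 1) ∉ S := by
  by_contra! hcon
  obtain ⟨hex, hstep⟩ := hcon
  obtain ⟨e, heS, he⟩ := Finset.not_disjoint_iff.1 h
  obtain ⟨i, -, rfl⟩ := Finset.mem_image.1 he
  have hall : ∀ k : ℕ, arcAt par v (i - (k : Fin (n + 2))) ∈ S := by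
    intro k
    induction k with
    | zero => simpa using heS
    | succ k ih =>
      have := hstep _ ih
      rwa [sub_sub, ← Nat.cast_succ] at this
  obtain ⟨j, hj⟩ := hex
  have := hall (i - j).val
  rw [Fin.cast_val_eq_self, sub_sub_cancel] at this
  exact hj this

lemma sum_pairs_le {p : ℝ} (h0 : 0 ≤ p) {par : Fin (n + 2) → Bool}
    (hℓ : ∀ b, (univ.filter fun j => par j = b).card ≤ ℓ) (F : Finset (Fin (n + 2) → V))
    (hF : ∀ v ∈ F, Function.Injective fun j => (par j, v j)) {v₀ : Fin (n + 2) → V}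
    (hv₀ : Function.Injective fun j => (par j, v₀ j)) :
    (∑ v ∈ F, if ¬ Disjoint (arcSet par v₀) (arcSet par v) then
      p ^ (arcSet par v₀ ∪ arcSet par v).card else 0) ≤
      p ^ (n + 2) * (ℓ + (n + 2) * (p * (ℓ * (Fintype.card V * p + 1) ^ n))) := by
  set S := arcSet par v₀ with hSdef
  have hS : IsFunctionalArcs S ℓ := isFunctionalArcs_arcSet hv₀ hℓ
  have harc : ∀ {v : Fin (n + 2) → V}, (Function.Injective fun j => (par j, v j)) →
      Function.Injective (arcAt par v) := fun hv j k h => hv (by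
    simp only [arcAt, Prod.mk.injEq] at h ⊢
    exact ⟨h.1, h.2.1⟩)
  have hScard : S.card = n + 2 := by
    rw [hSdef, arcSet, Finset.card_image_of_injective _ (harc hv₀), Finset.card_univ,
      Fintype.card_fin]
  set w : (Fin (n + 2) → V) → ℝ := fun v => ∏ j, (if arcAt par v j ∈ S then 1 else p) with hw
  have hw0 : ∀ v, 0 ≤ w v := fun v =>
    Finset.prod_nonneg fun j _ => by split_ifs <;> first | exact h0 | norm_num
  have hpow : ∀ v ∈ F, p ^ (S ∪ arcSet par v).card = p ^ (n + 2) * w v := by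
    intro v hv
    rw [Finset.card_union, ← hScard, hw]
    have : (S.card + (arcSet par v).card - (S ∩ arcSet par v).card) =
        S.card + (arcSet par v \ S).card := by
      have := Finset.card_sdiff_add_card_inter (arcSet par v) S
      rw [Finset.inter_comm] at this
      omega
    rw [this, pow_add]
    congr 1
    have e1 : arcSet par v \ S = (univ.filter fun j => arcAt par v j ∉ S).image (arcAt par v) := by
      ext e
      simp only [arcSet, Finset.mem_sdiff, Finset.mem_image, Finset.mem_univ, true_and,
        Finset.mem_filter]
      constructor
      · rintro ⟨⟨j, rfl⟩, h⟩
        exact ⟨j, h, rfl⟩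
      · rintro ⟨j, h, rfl⟩
        exact ⟨⟨j, rfl⟩, h⟩
    rw [e1, Finset.card_image_of_injective _ (harc (hF v hv))]
    simp [Finset.prod_ite]
  set B : (Fin (n + 2) → V) → ℝ := fun v => (if ∀ j, arcAt par v j ∈ S then 1 else 0) +
    ∑ i, if arcAt par v i ∈ S ∧ arcAt par v (i - 1) ∉ S then w v else 0 with hB
  have hsum0 : ∀ v, 0 ≤ ∑ i, if arcAt par v i ∈ S ∧ arcAt par v (i - 1) ∉ S then w v else 0 :=
    fun v => Finset.sum_nonneg fun i _ => by split_ifs <;> first | exact hw0 v | norm_num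
  have hB0 : ∀ v, 0 ≤ B v := fun v =>
    add_nonneg (by split_ifs <;> norm_num) (hsum0 v)
  have hterm : ∀ v ∈ F, (if ¬ Disjoint S (arcSet par v) then
      p ^ (S ∪ arcSet par v).card else 0) ≤ p ^ (n + 2) * B v := by
    intro v hv
    split_ifs with hd
    · exact mul_nonneg (by positivity) (hB0 v)
    rw [hpow v hv]
    refine mul_le_mul_of_nonneg_left ?_ (by positivity)
    rcases all_mem_or_enter hd with hall | ⟨i, hi⟩
    · have : w v = 1 := Finset.prod_eq_one fun j _ => if_pos (hall j)
      rw [this]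
      simp only [hB, if_pos hall]
      linarith [hsum0 v]
    · have h1 := Finset.single_le_sum (f := fun i =>
        if arcAt par v i ∈ S ∧ arcAt par v (i - 1) ∉ S then w v else 0)
        (fun i _ => by split_ifs <;> first | exact hw0 v | norm_num) (Finset.mem_univ i)
      simp only [if_pos hi] at h1
      have h2 : (0 : ℝ) ≤ if ∀ j, arcAt par v j ∈ S then 1 else 0 := by split_ifs <;> norm_num
      simp only [hB]
      linarith
  refine (Finset.sum_le_sum hterm).trans ?_
  rw [← Finset.mul_sum]
  refine mul_le_mul_of_nonneg_left ?_ (by positivity)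
  refine (Finset.sum_le_sum_of_subset_of_nonneg (Finset.subset_univ F)
    fun v _ _ => hB0 v).trans ?_
  simp only [hB, Finset.sum_add_distrib]
  refine add_le_add (hS.sum_all_mem_le par) ?_
  rw [Finset.sum_comm]
  refine (Finset.sum_le_sum fun i _ => hS.sum_enter_le h0 par i).trans_eq ?_
  simp

end Walks

section CycleWalks

variable {d m : ℕ}

/-- The type of a position of a cycle: even positions are rows, odd ones columns. -/
def posType (d : ℕ) (j : Fin (2 * d + 2)) : Bool := decide (j.val % 2 = 1)

/-- The closed walk through the rows `r` and the columns `c`. -/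
def cycleWalk (rc : (ZMod (d + 1) ↪ Fin m) × (ZMod (d + 1) ↪ Fin m)) (j : Fin (2 * d + 2)) :
    Fin m :=
  if posType d j then rc.2 ((j.val / 2 : ℕ) : ZMod (d + 1))
  else rc.1 ((j.val / 2 : ℕ) : ZMod (d + 1))

lemma card_posType_le (d : ℕ) (b : Bool) :
    (univ.filter fun j => posType d j = b).card ≤ d + 1 := by
  rw [← Finset.card_range (d + 1)]
  refine Finset.card_le_card_of_injOn (fun j => j.val / 2) (fun j _ => ?_) fun j hj k hk h => ?_
  · have := j.isLt
    simp only [Finset.coe_range, Set.mem_Iio]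
    omega
  · simp only [Finset.coe_filter, Finset.mem_univ, true_and, Set.mem_ofPred_eq] at hj hk
    have hjk := hj.trans hk.symm
    simp only [posType, decide_eq_decide] at hjk
    simp only at h
    ext
    omega

lemma natCast_half_injective {j k : ℕ} (hj : j < 2 * d + 2) (hk : k < 2 * d + 2)
    (h : ((j / 2 : ℕ) : ZMod (d + 1)) = ((k / 2 : ℕ) : ZMod (d + 1))) : j / 2 = k / 2 := by
  rw [ZMod.natCast_eq_natCast_iff', Nat.mod_eq_of_lt (by omega), Nat.mod_eq_of_lt (by omega)] at h
  exact h

lemma cycleWalk_good (rc : (ZMod (d + 1) ↪ Fin m) × (ZMod (d + 1) ↪ Fin m)) :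
    Function.Injective fun j => (posType d j, cycleWalk rc j) := by
  intro j k h
  simp only [Prod.mk.injEq] at h
  obtain ⟨h1, h2⟩ := h
  have hhalf : j.val / 2 = k.val / 2 := by
    simp only [cycleWalk, h1] at h2
    apply natCast_half_injective j.isLt k.isLt
    split_ifs at h2
    · exact rc.2.injective h2
    · exact rc.1.injective h2
  simp only [posType, decide_eq_decide] at h1
  ext
  omega

lemma cycleWalk_even (rc : (ZMod (d + 1) ↪ Fin m) × (ZMod (d + 1) ↪ Fin m)) (k : ZMod (d + 1)) :
    ∃ j, posType d j = false ∧ cycleWalk rc j = rc.1 k ∧ j.val = 2 * k.val := by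
  have hk := ZMod.val_lt k
  refine ⟨⟨2 * k.val, by omega⟩, by simp [posType], ?_, rfl⟩
  simp [cycleWalk, posType]

lemma cycleWalk_odd (rc : (ZMod (d + 1) ↪ Fin m) × (ZMod (d + 1) ↪ Fin m)) (k : ZMod (d + 1)) :
    ∃ j, posType d j = true ∧ cycleWalk rc j = rc.2 k ∧ j.val = 2 * k.val + 1 := by
  have hk := ZMod.val_lt k
  refine ⟨⟨2 * k.val + 1, by omega⟩, by simp [posType], ?_, rfl⟩
  have : (2 * k.val + 1) / 2 = k.val := by omega
  simp [cycleWalk, posType, this]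

lemma cycleWalk_injective : Function.Injective (cycleWalk (d := d) (m := m)) := by
  intro rc rc' h
  refine Prod.ext (Function.Embedding.ext fun k => ?_) (Function.Embedding.ext fun k => ?_)
  · obtain ⟨j, -, h1, hj⟩ := cycleWalk_even rc k
    obtain ⟨j', -, h2, hj'⟩ := cycleWalk_even rc' k
    have : j = j' := Fin.ext (hj.trans hj'.symm)
    rw [← h1, ← h2, h, this]
  · obtain ⟨j, -, h1, hj⟩ := cycleWalk_odd rc k
    obtain ⟨j', -, h2, hj'⟩ := cycleWalk_odd rc' k
    have : j = j' := Fin.ext (hj.trans hj'.symm)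
    rw [← h1, ← h2, h, this]

lemma row_arc_mem (rc : (ZMod (d + 1) ↪ Fin m) × (ZMod (d + 1) ↪ Fin m)) (k : ZMod (d + 1)) :
    (false, rc.1 k, rc.2 k) ∈ arcSet (posType d) (cycleWalk rc) := by
  obtain ⟨j, h1, h2, hj⟩ := cycleWalk_even rc k
  obtain ⟨j', -, h4, hj'⟩ := cycleWalk_odd rc k
  have hk := ZMod.val_lt k
  have : j + 1 = j' := by
    ext
    rw [Fin.val_add, hj', hj, Fin.val_one, Nat.mod_eq_of_lt (by omega)]
  exact Finset.mem_image.2 ⟨j, Finset.mem_univ _, by rw [arcAt, h1, h2, this, h4]⟩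

lemma col_arc_mem (rc : (ZMod (d + 1) ↪ Fin m) × (ZMod (d + 1) ↪ Fin m)) (k : ZMod (d + 1)) :
    (true, rc.2 k, rc.1 (k + 1)) ∈ arcSet (posType d) (cycleWalk rc) := by
  obtain ⟨j, h1, h2, hj⟩ := cycleWalk_odd rc k
  obtain ⟨j', -, h4, hj'⟩ := cycleWalk_even rc (k + 1)
  have : j + 1 = j' := by
    ext
    rw [Fin.val_add, hj', hj, Fin.val_one, ZMod.val_add, ZMod.val_one_eq_one_mod, Nat.add_mod_mod,
      ← Nat.mul_mod_mul_left]
    congr 1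
  exact Finset.mem_image.2 ⟨j, Finset.mem_univ _, by rw [arcAt, h1, h2, this, h4]⟩

end CycleWalks

section Game

variable {n : ℕ}

/-- A pair of matrices as one configuration of typed arcs. -/
def configEquiv (n : ℕ) : (Fin n → Fin n → Bool) × (Fin n → Fin n → Bool) ≃
    (Bool × Fin n × Fin n → Bool) where
  toFun ω e := if e.1 then ω.1 e.2.2 e.2.1 else ω.2 e.2.1 e.2.2
  invFun τ := (fun i j => τ (true, j, i), fun i j => τ (false, i, j))
  left_inv ω := rfl
  right_inv τ := by
    funext ⟨b, i, j⟩
    cases b <;> rfl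

lemma pairWeight_eq {p : ℝ} (h0 : 0 ≤ p) (h1 : p ≤ 1)
    (ω : (Fin n → Fin n → Bool) × (Fin n → Fin n → Bool)) :
    pairWeight n p ω = ENNReal.ofReal (bernoulliWeight p (configEquiv n ω)) := by
  unfold bernoulliWeight
  rw [ENNReal.ofReal_prod_of_nonneg fun e _ => by split_ifs <;> linarith,
    Fintype.prod_prod_type, Fintype.prod_bool, Fintype.prod_prod_type, Fintype.prod_prod_type,
    Finset.prod_comm]
  have h : ∀ b : Bool, entryWeight p b = ENNReal.ofReal (if b then p else 1 - p) := fun b => by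
    cases b <;> rfl
  simp only [pairWeight, h]
  rfl

lemma gameMeasure_le {p : ℝ} (h0 : 0 ≤ p) (h1 : p ≤ 1)
    (E : Set ((Fin n → Fin n → Bool) × (Fin n → Fin n → Bool)))
    (f : (Bool × Fin n × Fin n → Bool) → ℝ) (hf0 : ∀ τ, 0 ≤ f τ)
    (hf : ∀ ω ∈ E, f (configEquiv n ω) = 1) :
    gameMeasure n p E ≤ ENNReal.ofReal (bernoulliExp p f) := by
  have hterm : ∀ ω, 0 ≤ bernoulliWeight p ω * f ω := fun ω =>
    mul_nonneg (bernoulliWeight_nonneg h0 h1 ω) (hf0 ω)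
  rw [gameMeasure, Measure.sum_apply _ (MeasurableSet.of_discrete), tsum_fintype, bernoulliExp,
    ← (configEquiv n).sum_comp, ENNReal.ofReal_sum_of_nonneg fun ω _ => hterm _]
  refine Finset.sum_le_sum fun ω _ => ?_
  rw [Measure.smul_apply, Measure.dirac_apply' _ (MeasurableSet.of_discrete), smul_eq_mul]
  by_cases hω : ω ∈ E
  · rw [Set.indicator_of_mem hω, hf ω hω, mul_one, Pi.one_apply, mul_one, pairWeight_eq h0 h1]
  · rw [Set.indicator_of_notMem hω, mul_zero]
    exact zero_le

/-- Arcs of the subgraph on the rows `eR` and the columns `eC`, as arcs of the whole graph. -/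
def arcEmb {m : ℕ} (eR eC : Fin m ↪ Fin n) : Bool × Fin m × Fin m ↪ Bool × Fin n × Fin n where
  toFun e := (e.1, if e.1 then (eC e.2.1, eR e.2.2) else (eR e.2.1, eC e.2.2))
  inj' := by
    rintro ⟨b, x, y⟩ ⟨b', x', y'⟩ h
    cases b <;> cases b' <;> simp_all

/-- The probability that there is no `2(d+1)`-cycle inside given sets of rows and columns. -/
lemma gameMeasure_no_cycle_le {d m : ℕ} {p : ℝ} (h0 : 0 ≤ p) (h1 : p ≤ 1) {R C : Finset (Fin n)}
    (hR : R.card = m) (hC : C.card = m) :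
    gameMeasure n p {ω | ¬ ∃ r c, IsCycle (d + 1) n ω.1 ω.2 r c ∧ (∀ k, r k ∈ R) ∧ ∀ k, c k ∈ C} ≤
      ENNReal.ofReal (Real.exp (-((m.descFactorial (d + 1) : ℝ) ^ 2 * p ^ (2 * d + 2)) /
        (2 * ((d + 1 : ℕ) + (2 * d + 2) * (p * ((d + 1 : ℕ) * (m * p + 1) ^ (2 * d))))))) := by
  set eR : Fin m ↪ Fin n := (R.orderEmbOfFin hR).toEmbedding with heR
  set eC : Fin m ↪ Fin n := (C.orderEmbOfFin hC).toEmbedding with heC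
  set A : (ZMod (d + 1) ↪ Fin m) × (ZMod (d + 1) ↪ Fin m) → Finset (Bool × Fin n × Fin n) :=
    fun rc => (arcSet (posType d) (cycleWalk rc)).map (arcEmb eR eC) with hA
  have hcard : ∀ rc, (A rc).card = 2 * d + 2 := fun rc => by
    rw [hA, Finset.card_map, arcSet, Finset.card_image_of_injective, Finset.card_univ,
      Fintype.card_fin]
    intro j k h
    apply cycleWalk_good rc
    simp only [arcAt, Prod.mk.injEq] at h ⊢
    exact ⟨h.1, h.2.1⟩
  have hμ : ∑ rc, p ^ (A rc).card = (m.descFactorial (d + 1) : ℝ) ^ 2 * p ^ (2 * d + 2) := by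
    simp only [hcard, Finset.sum_const, Finset.card_univ, Fintype.card_prod,
      Fintype.card_embedding_eq, ZMod.card, Fintype.card_fin, nsmul_eq_mul]
    push_cast
    ring
  have hX : (1 : ℝ) ≤ (d + 1 : ℕ) + (2 * d + 2) * (p * ((d + 1 : ℕ) * (m * p + 1) ^ (2 * d))) := by
    have : (0 : ℝ) ≤ (2 * d + 2) * (p * ((d + 1 : ℕ) * (m * p + 1) ^ (2 * d))) := by positivity
    push_cast at this ⊢
    linarith [(Nat.cast_nonneg d : (0 : ℝ) ≤ d)]
  have hpairs := janson_sparsified h0 h1 A hX (by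
    rw [Finset.mul_sum]
    refine Finset.sum_le_sum fun rc _ => ?_
    have h := sum_pairs_le (V := Fin m) (n := 2 * d) h0 (card_posType_le d)
      (univ.map ⟨cycleWalk, cycleWalk_injective⟩) (fun v hv => by
        obtain ⟨rc', -, rfl⟩ := Finset.mem_map.1 hv
        exact cycleWalk_good rc') (cycleWalk_good rc)
    rw [Finset.sum_map] at h
    simp only [Function.Embedding.coeFn_mk, Fintype.card_fin] at h
    rw [hcard, mul_comm]
    simp only [hA, Finset.disjoint_map, ← Finset.map_union, Finset.card_map]
    push_cast at h ⊢
    exact h)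
  rw [hμ] at hpairs
  refine (gameMeasure_le h0 h1 _ _ (noneTrue_nonneg A univ) ?_).trans
    (ENNReal.ofReal_le_ofReal hpairs)
  intro ω hω
  refine Finset.prod_eq_one fun rc _ => ?_
  rw [sub_eq_self, allTrue, if_neg]
  intro hall
  refine hω ⟨fun k => eR (rc.1 k), fun k => eC (rc.2 k),
    ⟨eR.injective.comp rc.1.injective, eC.injective.comp rc.2.injective, fun k => ?_, fun k => ?_⟩,
    fun k => Finset.orderEmbOfFin_mem R hR _, fun k => Finset.orderEmbOfFin_mem C hC _⟩
  · exact hall _ (Finset.mem_map_of_mem _ (row_arc_mem rc k))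
  · exact hall _ (Finset.mem_map_of_mem _ (col_arc_mem rc k))

end Game

section Greedy

lemma HasDisjCycles.exists_maximal {ℓ n : ℕ} {A B : Fin n → Fin n → Bool} {K : ℕ}
    (hK : ∀ M, HasDisjCycles ℓ n M A B → M < K) :
    ∃ M, HasDisjCycles ℓ n M A B ∧ ¬ HasDisjCycles ℓ n (M + 1) A B := by
  by_contra! hcon
  have hall : ∀ M, HasDisjCycles ℓ n M A B := by
    intro M
    induction M with
    | zero => exact ⟨Fin.elim0, Fin.elim0, fun t => t.elim0, fun t => t.elim0⟩
    | succ M ih => exact hcon M ih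
  exact lt_irrefl K (hK K (hall K))

/-- If there are few disjoint cycles, then some large sets of rows and columns span no cycle. -/
lemma exists_no_cycle_of_few {d n : ℕ} {A B : Fin n → Fin n → Bool}
    (h : ∀ M, HasDisjCycles (d + 1) n M A B → 2 * (M * (d + 1)) < n) :
    ∃ R ∈ powersetCard ((n + 1) / 2) (univ : Finset (Fin n)),
      ∃ C ∈ powersetCard ((n + 1) / 2) (univ : Finset (Fin n)),
        ¬ ∃ r c, IsCycle (d + 1) n A B r c ∧ (∀ k, r k ∈ R) ∧ ∀ k, c k ∈ C := by
  obtain ⟨M, ⟨r, c, hcyc, hdisj⟩, hmax⟩ := HasDisjCycles.exists_maximal (K := n) fun M hM => by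
    have := h M hM
    nlinarith
  have hM := h M ⟨r, c, hcyc, hdisj⟩
  have hfree : ∀ f : Fin M → ZMod (d + 1) → Fin n, ∃ R ∈ powersetCard ((n + 1) / 2)
      (univ : Finset (Fin n)), ∀ x ∈ R, ∀ t k, f t k ≠ x := by
    intro f
    set U : Finset (Fin n) := univ.image fun tk : Fin M × ZMod (d + 1) => f tk.1 tk.2 with hU
    have hUcard : U.card ≤ M * (d + 1) := by
      refine Finset.card_image_le.trans_eq ?_
      rw [Finset.card_univ, Fintype.card_prod, Fintype.card_fin, ZMod.card]
    have hcompl : (n + 1) / 2 ≤ Uᶜ.card := by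
      rw [Finset.card_compl, Fintype.card_fin]
      omega
    obtain ⟨R, hRU, hR⟩ := Finset.exists_subset_card_eq hcompl
    refine ⟨R, Finset.mem_powersetCard.2 ⟨Finset.subset_univ _, hR⟩, fun x hx t k hxk => ?_⟩
    refine Finset.mem_compl.1 (hRU hx) (Finset.mem_image.2 ⟨(t, k), Finset.mem_univ _, hxk⟩)
  obtain ⟨R, hR, hRf⟩ := hfree r
  obtain ⟨C, hC, hCf⟩ := hfree c
  refine ⟨R, hR, C, hC, ?_⟩
  rintro ⟨r', c', hcyc', hr', hc'⟩
  refine hmax ⟨Fin.cons r' r, Fin.cons c' c, fun t => ?_, fun s t hst => ?_⟩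
  · refine Fin.cases ?_ (fun t => ?_) t
    · exact hcyc'
    · exact hcyc t
  · induction s using Fin.cases with
    | zero =>
      induction t using Fin.cases with
      | zero => exact absurd rfl hst
      | succ t => exact ⟨fun k k' => (hRf _ (hr' k) t k').symm, fun k k' => (hCf _ (hc' k) t k').symm⟩
    | succ s =>
      induction t using Fin.cases with
      | zero => exact ⟨fun k k' => hRf _ (hr' k') s k, fun k k' => hCf _ (hc' k') s k⟩
      | succ t => exact hdisj s t fun h => hst (congrArg _ h)

end Greedy

section Binomial

lemma centralBinom_sq_le (k : ℕ) : (2 * k + 1) * k.centralBinom ^ 2 ≤ 16 ^ k := by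
  induction k with
  | zero => simp
  | succ k ih =>
    have h := Nat.succ_mul_centralBinom_succ k
    have h2 : (k + 1) ^ 2 * ((2 * (k + 1) + 1) * (k + 1).centralBinom ^ 2) ≤
        (k + 1) ^ 2 * 16 ^ (k + 1) := by
      calc (k + 1) ^ 2 * ((2 * (k + 1) + 1) * (k + 1).centralBinom ^ 2)
          = (2 * k + 3) * ((k + 1) * (k + 1).centralBinom) ^ 2 := by ring
        _ = (4 * ((2 * k + 3) * (2 * k + 1))) * ((2 * k + 1) * k.centralBinom ^ 2) := by
            rw [h]; ring
        _ ≤ (16 * (k + 1) ^ 2) * 16 ^ k := Nat.mul_le_mul (by nlinarith) ih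
        _ = _ := by ring
    exact Nat.le_of_mul_le_mul_left h2 (by positivity)

lemma choose_half_sq_mul_le (n : ℕ) : n.choose ((n + 1) / 2) ^ 2 * n ≤ 4 ^ n := by
  rcases Nat.even_or_odd' n with ⟨k, rfl | rfl⟩
  · have h : (2 * k + 1) / 2 = k := by omega
    rw [h, pow_mul, ← Nat.centralBinom_eq_two_mul_choose]
    have := centralBinom_sq_le k
    norm_num
    nlinarith [sq_nonneg k.centralBinom]
  · have h : (2 * k + 1 + 1) / 2 = k + 1 := by omega
    have hc : 2 * (2 * k + 1).choose (k + 1) = (k + 1).centralBinom := by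
      rw [Nat.centralBinom_eq_two_mul_choose, show 2 * (k + 1) = (2 * k + 1) + 1 by ring,
        Nat.choose_succ_succ (2 * k + 1) k, ← Nat.choose_symm_half k]
      ring
    rw [h]
    have h1 := centralBinom_sq_le (k + 1)
    rw [← hc] at h1
    have h2 : (4 : ℕ) ^ (2 * k + 1) = 4 * 16 ^ k := by
      rw [pow_succ, pow_mul]; norm_num [mul_comm]
    rw [h2]
    rw [pow_succ 16 k] at h1
    nlinarith [sq_nonneg ((2 * k + 1).choose (k + 1))]

end Binomial

section Asymptotics

lemma descFactorial_sq_ge {m ℓ : ℕ} (hm : 0 < m) (h : (ℓ : ℝ) ^ 2 ≤ m / 12) :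
    2 / 3 * (m : ℝ) ^ (2 * ℓ) ≤ (m.descFactorial ℓ : ℝ) ^ 2 := by
  have hm' : (0 : ℝ) < m := by exact_mod_cast hm
  have hℓm : (ℓ : ℝ) ≤ m := by
    rcases Nat.eq_zero_or_pos ℓ with rfl | hℓ
    · simp
    · have : (1 : ℝ) ≤ ℓ := by exact_mod_cast hℓ
      nlinarith
  have hle : (ℓ : ℕ) ≤ m := by exact_mod_cast hℓm
  have h1 : ((m : ℝ) - ℓ) ^ ℓ ≤ m.descFactorial ℓ := by
    have h2 : (m - ℓ) ^ ℓ ≤ m.descFactorial ℓ :=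
      (Nat.pow_le_pow_left (by omega) ℓ).trans (Nat.pow_sub_le_descFactorial m ℓ)
    rw [← Nat.cast_sub hle]
    exact_mod_cast h2
  have h3 : 11 / 12 ≤ (1 + -(ℓ / m : ℝ)) ^ ℓ := by
    refine le_trans ?_ (one_add_mul_le_pow ?_ ℓ)
    · have : (ℓ : ℝ) * (ℓ / m) ≤ 1 / 12 := by
        rw [← mul_div_assoc, div_le_iff₀ hm']
        linarith
      linarith
    · have : (ℓ / m : ℝ) ≤ 1 := (div_le_one hm').2 hℓm
      linarith
  have h4 : 11 / 12 * (m : ℝ) ^ ℓ ≤ m.descFactorial ℓ := by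
    refine le_trans ?_ h1
    calc 11 / 12 * (m : ℝ) ^ ℓ ≤ (1 + -(ℓ / m : ℝ)) ^ ℓ * (m : ℝ) ^ ℓ := by gcongr
      _ = _ := by
        rw [← mul_pow]
        congr 1
        field_simp
        ring
  have h5 : (0 : ℝ) ≤ (m : ℝ) ^ ℓ := by positivity
  rw [mul_comm 2 ℓ, pow_mul]
  nlinarith [pow_le_pow_left₀ (by positivity) h4 2]

lemma add_one_pow_le_two_mul_pow {y : ℝ} {k : ℕ} (hy : 0 < y) (hk : (k : ℝ) ≤ y / 2) :
    (y + 1) ^ k ≤ 2 * y ^ k := by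
  have h1 : 1 / 2 ≤ (1 + -(1 / (y + 1))) ^ k := by
    refine le_trans ?_ (one_add_mul_le_pow ?_ k)
    · have : (k : ℝ) * (1 / (y + 1)) ≤ 1 / 2 := by
        rw [mul_one_div, div_le_iff₀ (by linarith)]
        linarith
      linarith
    · have : 1 / (y + 1) ≤ 1 := (div_le_one (by linarith)).2 (by linarith)
      linarith
  have h2 : y ^ k = (1 + -(1 / (y + 1))) ^ k * (y + 1) ^ k := by
    rw [← mul_pow]
    congr 1
    field_simp
    ring
  rw [h2]
  nlinarith [pow_pos (show 0 < y + 1 by linarith) k]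

/-- The exponent in the Janson bound dominates one of the two target exponents. -/
lemma exponent_bound {n m d : ℕ} {p : ℝ} (h0 : 0 < p) (h1 : p ≤ 1) (hm : 0 < m) (hnm : n ≤ 2 * m)
    (hd : ((d + 1 : ℕ) : ℝ) ^ 2 ≤ m * p / 12) :
    Real.exp (-((m.descFactorial (d + 1) : ℝ) ^ 2 * p ^ (2 * d + 2)) /
        (2 * ((d + 1 : ℕ) + (2 * d + 2) * (p * ((d + 1 : ℕ) * (m * p + 1) ^ (2 * d)))))) ≤
      Real.exp (-(((n : ℝ) * p) ^ (2 * (d + 1))) /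
          (6 * ((d + 1 : ℕ) : ℝ) * 2 ^ (2 * (d + 1)))) +
        Real.exp (-((n : ℝ) ^ 2 * p) / (150 * ((d + 1 : ℕ) : ℝ) ^ 8)) := by
  have hm' : (0 : ℝ) < m := by exact_mod_cast hm
  have hnm' : (n : ℝ) ≤ 2 * m := by exact_mod_cast hnm
  set y : ℝ := m * p with hy
  have hy0 : 0 < y := by positivity
  have hym : y ≤ m := by nlinarith
  set l : ℝ := ((d + 1 : ℕ) : ℝ) with hl
  have hld : l = d + 1 := by rw [hl]; push_cast; ring
  have hl1 : 1 ≤ l := by rw [hld]; linarith [(Nat.cast_nonneg d : (0 : ℝ) ≤ d)]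
  have hD := descFactorial_sq_ge (ℓ := d + 1) hm (by linarith)
  have hpow := add_one_pow_le_two_mul_pow (k := 2 * d) hy0 (by
    push_cast
    nlinarith)
  set μ : ℝ := (m.descFactorial (d + 1) : ℝ) ^ 2 * p ^ (2 * d + 2) with hμ
  have hμy : 2 / 3 * y ^ (2 * d + 2) ≤ μ := by
    rw [hy, mul_pow, ← mul_assoc]
    exact mul_le_mul_of_nonneg_right hD (by positivity)
  set Y : ℝ := (2 * d + 2) * (p * (l * (y + 1) ^ (2 * d))) with hY
  have hYle : Y ≤ 4 * l ^ 2 * p * y ^ (2 * d) := by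
    calc Y = 2 * l ^ 2 * p * (y + 1) ^ (2 * d) := by rw [hY, hld]; ring
      _ ≤ 2 * l ^ 2 * p * (2 * y ^ (2 * d)) := by gcongr
      _ = _ := by ring
  have hY0 : 0 ≤ Y := by positivity
  simp only [neg_div]
  rcases le_total Y l with hcase | hcase
  · refine le_trans (Real.exp_le_exp.2 (neg_le_neg ?_)) (le_add_of_nonneg_right (Real.exp_pos _).le)
    calc ((n : ℝ) * p) ^ (2 * (d + 1)) / (6 * l * 2 ^ (2 * (d + 1)))
        ≤ (2 * y) ^ (2 * (d + 1)) / (6 * l * 2 ^ (2 * (d + 1))) := by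
          have hny : (n : ℝ) * p ≤ 2 * y := by rw [hy]; nlinarith
          exact div_le_div_of_nonneg_right (pow_le_pow_left₀ (by positivity) hny _) (by positivity)
      _ = (2 / 3 * y ^ (2 * d + 2)) / (2 * (2 * l)) := by
          rw [mul_pow]
          field_simp
          ring
      _ ≤ μ / (2 * (l + Y)) := by
          gcongr
          linarith
  · refine le_trans (Real.exp_le_exp.2 (neg_le_neg ?_)) (le_add_of_nonneg_left (Real.exp_pos _).le)
    calc (n : ℝ) ^ 2 * p / (150 * l ^ 8) ≤ (2 * m : ℝ) ^ 2 * p / (96 * l ^ 2) := by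
          have : l ^ 2 ≤ l ^ 8 := pow_le_pow_right₀ hl1 (by norm_num)
          gcongr
          norm_num
      _ = (2 / 3 * y ^ (2 * d + 2)) / (2 * (2 * (4 * l ^ 2 * p * y ^ (2 * d)))) := by
          rw [pow_add, hy]
          field_simp
          ring
      _ ≤ μ / (2 * (l + Y)) := by
          gcongr
          linarith

end Asymptotics

/-- The union bound over the choice of the sets of rows and columns left uncovered. -/
lemma gameMeasure_few_le {n d : ℕ} {p E : ℝ} (h0 : 0 ≤ p) (h1 : p ≤ 1) (hn : 0 < n)
    (hE : Real.exp (-((((n + 1) / 2).descFactorial (d + 1) : ℝ) ^ 2 * p ^ (2 * d + 2)) /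
        (2 * ((d + 1 : ℕ) + (2 * d + 2) *
          (p * ((d + 1 : ℕ) * (((n + 1) / 2 : ℕ) * p + 1) ^ (2 * d)))))) ≤ E) :
    gameMeasure n p {ω | ¬ ∃ m : ℕ, (n : ℝ) / (2 * ((d + 1 : ℕ) : ℝ)) ≤ (m : ℝ) ∧
        HasDisjCycles (d + 1) n m ω.1 ω.2} ≤ ENNReal.ofReal ((4 : ℝ) ^ n / n * E) := by
  set P := powersetCard ((n + 1) / 2) (univ : Finset (Fin n)) with hP
  have hE0 : 0 ≤ E := (Real.exp_pos _).le.trans hE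
  have hPcard : P.card = n.choose ((n + 1) / 2) := by
    rw [hP, Finset.card_powersetCard, Finset.card_univ, Fintype.card_fin]
  have hsub : {ω : (Fin n → Fin n → Bool) × (Fin n → Fin n → Bool) |
      ¬ ∃ m : ℕ, (n : ℝ) / (2 * ((d + 1 : ℕ) : ℝ)) ≤ (m : ℝ) ∧
        HasDisjCycles (d + 1) n m ω.1 ω.2} ⊆ ⋃ RC ∈ P ×ˢ P,
      {ω | ¬ ∃ r c, IsCycle (d + 1) n ω.1 ω.2 r c ∧ (∀ k, r k ∈ RC.1) ∧ ∀ k, c k ∈ RC.2} := by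
    intro ω hω
    obtain ⟨R, hR, C, hC, h⟩ := exists_no_cycle_of_few (d := d) (A := ω.1) (B := ω.2)
      fun M hM => by
        by_contra! hcon
        refine hω ⟨M, ?_, hM⟩
        rw [div_le_iff₀ (by positivity)]
        have : (n : ℝ) ≤ ((2 * (M * (d + 1)) : ℕ) : ℝ) := by exact_mod_cast hcon
        push_cast at this ⊢
        linarith
    exact Set.mem_biUnion (x := (R, C)) (Finset.mem_product.2 ⟨hR, hC⟩) h
  refine (measure_mono hsub).trans ((measure_biUnion_finset_le _ _).trans ?_)
  have hterm : ∀ RC ∈ P ×ˢ P, gameMeasure n p {ω | ¬ ∃ r c, IsCycle (d + 1) n ω.1 ω.2 r c ∧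
      (∀ k, r k ∈ RC.1) ∧ ∀ k, c k ∈ RC.2} ≤ ENNReal.ofReal E := by
    intro RC hRC
    obtain ⟨hR, hC⟩ := Finset.mem_product.1 hRC
    exact (gameMeasure_no_cycle_le h0 h1 (Finset.mem_powersetCard.1 hR).2
      (Finset.mem_powersetCard.1 hC).2).trans (ENNReal.ofReal_le_ofReal hE)
  refine (Finset.sum_le_card_nsmul _ _ _ hterm).trans ?_
  rw [Finset.card_product, hPcard, nsmul_eq_mul, ← ENNReal.ofReal_natCast,
    ← ENNReal.ofReal_mul (by positivity)]
  refine ENNReal.ofReal_le_ofReal (mul_le_mul_of_nonneg_right ?_ hE0)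
  rw [le_div_iff₀ (by positivity), ← sq]
  exact_mod_cast choose_half_sq_mul_le n

theorem few_disjoint_cycles_prob (p : ℕ → ℝ) (hp : ∀ n, 0 ≤ p n ∧ p n ≤ 1)
    (ℓ : ℕ → ℕ) (hℓ : ∀ n, 1 ≤ ℓ n)
    (hlim : Tendsto (fun n => (ℓ n : ℝ) / Real.sqrt ((n : ℝ) * p n)) atTop (nhds 0)) :
    ∃ N : ℕ, ∀ n : ℕ, N ≤ n →
      gameMeasure n (p n)
          {ω | ¬ ∃ m : ℕ, (n : ℝ) / (2 * (ℓ n : ℝ)) ≤ (m : ℝ) ∧ HasDisjCycles (ℓ n) n m ω.1 ω.2}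
        ≤ ENNReal.ofReal
            ((4 : ℝ) ^ n / n *
                Real.exp (-(((n : ℝ) * p n) ^ (2 * ℓ n)) / (6 * (ℓ n : ℝ) * 2 ^ (2 * ℓ n)))
              + (4 : ℝ) ^ n / n *
                Real.exp (-((n : ℝ) ^ 2 * p n) / (150 * (ℓ n : ℝ) ^ 8))) := by
  have hev := (hlim.eventually_lt_const (show (0 : ℝ) < 1 / 5 by norm_num)).and
    (eventually_gt_atTop 0)
  obtain ⟨N, hN⟩ := eventually_atTop.1 hev
  refine ⟨N, fun n hn => ?_⟩
  obtain ⟨hsmall, hn0⟩ := hN n hn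
  obtain ⟨h0, h1⟩ := hp n
  obtain ⟨d, hd⟩ : ∃ d, ℓ n = d + 1 := ⟨ℓ n - 1, by have := hℓ n; omega⟩
  rw [hd] at hsmall ⊢
  rw [← mul_add]
  refine gameMeasure_few_le h0 h1 hn0 ?_
  rcases h0.eq_or_lt with hp0 | hp0
  · rw [← hp0]
    simp
  · refine exponent_bound hp0 h1 (by omega) (by omega) ?_
    have hnp : 0 < (n : ℝ) * p n := by positivity
    rw [div_lt_iff₀ (Real.sqrt_pos.2 hnp)] at hsmall
    have hsq := pow_le_pow_left₀ (by positivity) hsmall.le 2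
    rw [mul_pow, Real.sq_sqrt hnp.le] at hsq
    have hm : (n : ℝ) ≤ 2 * ((n + 1) / 2 : ℕ) := by
      have : n ≤ 2 * ((n + 1) / 2) := by omega
      exact_mod_cast this
    nlinarith
end

section
/- For every real p > 0 and all integers N, ℓ with N > ℓ > 0, one has Σ_{s=1}^{ℓ} C(ℓ,s) · C(N−ℓ, ℓ−s) · p^{−s} ≤ C(N,ℓ) · (1 + ℓ/(Np))^{ℓ} − C(N−ℓ, ℓ), where C(a,b) denotes the binomial coefficient a choose b. -/
open MeasureTheory Filter Finset
open scoped ENNReal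

theorem choose_sub_mul_pow_le {N k s : ℕ} (hk : k ≤ N) (hs : s ≤ k) :
    (N - s).choose (k - s) * N ^ s ≤ N.choose k * k ^ s := by
  induction s with
  | zero => simp
  | succ s ih =>
    obtain ⟨b, rfl⟩ : ∃ b, k = b + (s + 1) := ⟨k - (s + 1), by omega⟩
    obtain ⟨a, rfl⟩ : ∃ a, N = a + (s + 1) := ⟨N - (s + 1), by omega⟩
    have hba : b ≤ a := by omega
    have ih := ih (by omega)
    rw [show a + (s + 1) - s = a + 1 by omega, show b + (s + 1) - s = b + 1 by omega] at ih
    rw [Nat.add_sub_cancel, Nat.add_sub_cancel]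
    have step : a.choose b * (a + (s + 1)) ≤ (a + 1).choose (b + 1) * (b + (s + 1)) := by
      refine Nat.le_of_mul_le_mul_left (c := a + 1) ?_ a.succ_pos
      calc (a + 1) * (a.choose b * (a + (s + 1)))
          = (a + 1).choose (b + 1) * ((b + 1) * (a + (s + 1))) := by
            rw [← mul_assoc, Nat.add_one_mul_choose_eq, mul_assoc]
        _ ≤ (a + 1).choose (b + 1) * ((a + 1) * (b + (s + 1))) :=
            Nat.mul_le_mul_left _ (by nlinarith)
        _ = _ := by ring
    calc a.choose b * (a + (s + 1)) ^ (s + 1)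
        = a.choose b * (a + (s + 1)) * (a + (s + 1)) ^ s := by ring
      _ ≤ (a + 1).choose (b + 1) * (b + (s + 1)) * (a + (s + 1)) ^ s := by gcongr
      _ = (a + 1).choose (b + 1) * (a + (s + 1)) ^ s * (b + (s + 1)) := by ring
      _ ≤ (a + (s + 1)).choose (b + (s + 1)) * (b + (s + 1)) ^ s * (b + (s + 1)) := by gcongr
      _ = _ := by ring

theorem hypergeometric_binomial_sum_bound (p : ℝ) (hp : 0 < p) (N ℓ : ℕ)
    (hℓ0 : 0 < ℓ) (hℓN : ℓ < N) :
    ∑ s ∈ Finset.Icc 1 ℓ,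
        (ℓ.choose s : ℝ) * ((N - ℓ).choose (ℓ - s) : ℝ) * p ^ (-(s : ℤ))
      ≤ (N.choose ℓ : ℝ) * (1 + (ℓ : ℝ) / ((N : ℝ) * p)) ^ ℓ - ((N - ℓ).choose ℓ : ℝ) := by
  have hN : (0 : ℝ) < N := by exact_mod_cast hℓ0.trans hℓN
  have coeff_le : ∀ s ≤ ℓ,
      ((N - ℓ).choose (ℓ - s) : ℝ) ≤ (N.choose ℓ : ℝ) * ((ℓ : ℝ) / N) ^ s := by
    intro s hs
    rw [div_pow, ← mul_div_assoc, le_div_iff₀ (pow_pos hN s)]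
    have h := (Nat.mul_le_mul_right (N ^ s)
      (Nat.choose_le_choose (ℓ - s) (Nat.sub_le_sub_left hs N))).trans
      (choose_sub_mul_pow_le hℓN.le hs)
    exact_mod_cast h
  rw [le_sub_iff_add_le]
  calc _ = ∑ s ∈ Finset.range (ℓ + 1),
        (ℓ.choose s : ℝ) * ((N - ℓ).choose (ℓ - s) : ℝ) * p ^ (-(s : ℤ)) := by
        rw [Finset.range_eq_Ico, Finset.sum_eq_sum_Ico_succ_bot (Nat.succ_pos ℓ), add_comm]
        simp [Finset.Ico_add_one_right_eq_Icc]
    _ ≤ ∑ s ∈ Finset.range (ℓ + 1),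
        (ℓ.choose s : ℝ) * ((N.choose ℓ : ℝ) * ((ℓ : ℝ) / N) ^ s) * p ^ (-(s : ℤ)) := by
        refine Finset.sum_le_sum fun s hs => ?_
        gcongr
        exact coeff_le s (Nat.lt_succ_iff.mp (Finset.mem_range.mp hs))
    _ = _ := by
        rw [add_comm 1, add_pow, Finset.mul_sum]
        refine Finset.sum_congr rfl fun s _ => ?_
        rw [zpow_neg, zpow_natCast, one_pow, ← div_div, div_pow _ p]
        ring
end

section
/- Assume n p² < 3, let d(n,p) = 2^{20}/(n² p⁴), and let t = ⌈n/100⌉. Then under P_{n,p}, the probability that there exist t pairwise disjoint bad localized pairs of rows — i.e., t pairs (i_1,j_1),…,(i_t,j_t) of rows with 0 < j_k − i_k ≤ d(n,p) for every k, the 2t rows all distinct, and each pair having at least three common out-neighbours — is at most (e⁴ · 2^{20} · n² p² / (27 t))^{t}. -/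
open MeasureTheory Filter Finset
open scoped ENNReal

lemma sum_entryWeight (p : ℝ) (hp0 : 0 ≤ p) (hp1 : p ≤ 1) : ∑ b, entryWeight p b = 1 := by
  simp only [entryWeight, Fintype.sum_bool, if_true, Bool.false_eq_true, if_false]
  rw [← ENNReal.ofReal_add hp0 (by linarith)]
  simp

lemma sum_prod_prod_matrix {n : ℕ} (g : Fin n → Fin n → Bool → ℝ≥0∞) :
    ∑ M : Fin n → Fin n → Bool, ∏ i, ∏ j, g i j (M i j) = ∏ i, ∏ j, ∑ b, g i j b := by
  classical
  simp_rw [Fintype.prod_sum]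

/-- The probability that all entries of the second matrix in a given set of cells are one. -/
lemma gameMeasure_forall_cells {n : ℕ} {p : ℝ} (hp0 : 0 ≤ p) (hp1 : p ≤ 1)
    (C : Finset (Fin n × Fin n)) :
    gameMeasure n p {ω | ∀ c ∈ C, ω.2 c.1 c.2 = true} = ENNReal.ofReal p ^ C.card := by
  classical
  have hind (M : Fin n → Fin n → Bool) :
      (∏ i, ∏ j, entryWeight p (M i j)) * (if ∀ c ∈ C, M c.1 c.2 = true then 1 else 0) =
        ∏ i, ∏ j, (entryWeight p (M i j) * if (i, j) ∈ C → M i j = true then 1 else 0) := by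
    simp_rw [Finset.prod_mul_distrib]
    congr 1
    simp_rw [Finset.prod_ite_zero, Finset.prod_const_one]
    simp only [mem_univ, forall_const]
    rw [Finset.prod_ite_zero]
    simp
  have hcell (i j : Fin n) :
      ∑ b, (entryWeight p b * if (i, j) ∈ C → b = true then 1 else 0) =
        if (i, j) ∈ C then ENNReal.ofReal p else 1 := by
    by_cases h : (i, j) ∈ C
    · simp [h, entryWeight]
    · simpa [h] using sum_entryWeight p hp0 hp1
  have hdirac (ω : (Fin n → Fin n → Bool) × (Fin n → Fin n → Bool)) :
      (pairWeight n p ω • Measure.dirac ω) {ω | ∀ c ∈ C, ω.2 c.1 c.2 = true} =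
        (∏ i, ∏ j, entryWeight p (ω.1 i j)) *
          ∏ i, ∏ j, (entryWeight p (ω.2 i j) * if (i, j) ∈ C → ω.2 i j = true then 1 else 0) := by
    rw [← hind, Measure.smul_apply, Measure.dirac_apply' _ (Set.toFinite _).measurableSet,
      pairWeight, smul_eq_mul, mul_assoc]
    simp [Set.indicator_apply]
  rw [gameMeasure, Measure.sum_apply _ (Set.toFinite _).measurableSet, tsum_fintype]
  simp_rw [hdirac]
  rw [Fintype.sum_prod_type]
  refine (Fintype.sum_mul_sum (fun M : Fin n → Fin n → Bool => ∏ i, ∏ j, entryWeight p (M i j))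
    (fun M : Fin n → Fin n → Bool =>
      ∏ i, ∏ j, (entryWeight p (M i j) * if (i, j) ∈ C → M i j = true then 1 else 0))).symm.trans ?_
  rw [sum_prod_prod_matrix fun _ _ b => entryWeight p b,
    sum_prod_prod_matrix fun i j b => entryWeight p b * if (i, j) ∈ C → b = true then 1 else 0]
  simp_rw [hcell, sum_entryWeight p hp0 hp1]
  rw [← Fintype.prod_prod_type' fun i j => if (i, j) ∈ C then ENNReal.ofReal p else 1]
  simp

/-- The pairs of rows at positive distance at most `d`. -/
noncomputable def localizedPairs (n : ℕ) (d : ℝ) : Finset (Fin n × Fin n) :=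
  univ.filter fun e => (e.1 : ℕ) < e.2 ∧ (e.2 : ℝ) - e.1 ≤ d

lemma card_localizedPairs_le (n : ℕ) {d : ℝ} (hd : 0 ≤ d) :
    ((localizedPairs n d).card : ℝ) ≤ n * d := by
  have hcard : (localizedPairs n d).card ≤ n * ⌊d⌋₊ := by
    have hsub : (localizedPairs n d).card ≤
        ((univ : Finset (Fin n)) ×ˢ Finset.Ioc 0 ⌊d⌋₊).card := by
      refine Finset.card_le_card_of_injOn (fun e => (e.1, (e.2 : ℕ) - e.1)) ?_ ?_
      · intro e he
        simp only [localizedPairs, coe_filter, mem_univ, true_and, Set.mem_ofPred_eq] at he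
        simp only [coe_product, Set.mem_prod, coe_univ, Set.mem_univ, coe_Ioc, Set.mem_Ioc,
          true_and]
        refine ⟨by omega, Nat.le_floor ?_⟩
        rw [Nat.cast_sub he.1.le]
        exact he.2
      · rintro ⟨a, b⟩ he ⟨a', b'⟩ he' h
        simp only [localizedPairs, coe_filter, mem_univ, true_and, Set.mem_ofPred_eq] at he he'
        simp only [Prod.mk.injEq] at h ⊢
        obtain ⟨rfl, h⟩ := h
        exact ⟨rfl, Fin.ext (by omega)⟩
    simpa using hsub
  calc ((localizedPairs n d).card : ℝ) ≤ n * ⌊d⌋₊ := by exact_mod_cast hcard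
    _ ≤ n * d := by gcongr; exact Nat.floor_le hd

/-- The cells that witness three common out-neighbours of a pair of rows. -/
def witnessCells {n : ℕ} (x : (Fin n × Fin n) × Finset (Fin n)) : Finset (Fin n × Fin n) :=
  {x.1.1, x.1.2} ×ˢ x.2

lemma card_biUnion_witnessCells {n t : ℕ} {a b : Fin t → Fin n} {S : Fin t → Finset (Fin n)}
    (ha : Function.Injective a) (hb : Function.Injective b) (hab : ∀ k k', a k ≠ b k')
    (hS : ∀ k, (S k).card = 3) :
    ((univ.image fun k => ((a k, b k), S k)).biUnion witnessCells).card = 6 * t := by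
  classical
  rw [Finset.image_biUnion, Finset.card_biUnion]
  · have (k : Fin t) : (witnessCells ((a k, b k), S k)).card = 6 := by
      simp [witnessCells, Finset.card_product, hS, Finset.card_pair (hab k k)]
    simp [this, mul_comm]
  · intro k _ k' _ hk
    change Disjoint _ _
    rw [Finset.disjoint_left]
    rintro ⟨r, c⟩ h h'
    simp only [witnessCells, mem_product, mem_insert, mem_singleton] at h h'
    rcases h.1 with h1 | h1 <;> rcases h'.1 with h2 | h2
    · exact hk (ha (h1.symm.trans h2))
    · exact hab _ _ (h1.symm.trans h2)
    · exact hab _ _ (h2.symm.trans h1)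
    · exact hk (hb (h1.symm.trans h2))

lemma choose_le_exp_mul_div_pow (M t : ℕ) :
    (M.choose t : ℝ) ≤ (Real.exp 1 * M / t) ^ t := by
  rcases Nat.eq_zero_or_pos t with rfl | ht
  · simp
  have htR : (0 : ℝ) < t := by exact_mod_cast ht
  calc (M.choose t : ℝ) ≤ (M : ℝ) ^ t / t.factorial := Nat.choose_le_pow_div t M
    _ = (M / t : ℝ) ^ t * ((t : ℝ) ^ t / t.factorial) := by
      rw [div_pow]; field_simp
    _ ≤ (M / t : ℝ) ^ t * Real.exp t := by
      gcongr
      exact Real.pow_div_factorial_le_exp _ htR.le t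
    _ = (Real.exp 1 * M / t) ^ t := by
      rw [← Real.exp_one_pow, ← mul_pow]; ring

lemma card_witnesses_mul_pow_le {n : ℕ} (hn : 1 ≤ n) {p : ℝ} (hp0 : 0 ≤ p) :
    ((localizedPairs n (2 ^ 20 / ((n : ℝ) ^ 2 * p ^ 4)) ×ˢ
        powersetCard 3 (univ : Finset (Fin n))).card : ℝ) * p ^ 6 ≤
      2 ^ 20 * (n : ℝ) ^ 2 * p ^ 2 / 6 := by
  rcases hp0.eq_or_lt with rfl | hp
  · simp
  have hnR : (0 : ℝ) < n := by exact_mod_cast hn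
  have hL := card_localizedPairs_le n (d := 2 ^ 20 / ((n : ℝ) ^ 2 * p ^ 4)) (by positivity)
  have hC : (n.choose 3 : ℝ) ≤ (n : ℝ) ^ 3 / 6 := by
    simpa [Nat.factorial] using Nat.choose_le_pow_div (α := ℝ) 3 n
  rw [Finset.card_product, Finset.card_powersetCard, Finset.card_univ, Fintype.card_fin]
  push_cast
  calc _ ≤ (n * (2 ^ 20 / ((n : ℝ) ^ 2 * p ^ 4))) * ((n : ℝ) ^ 3 / 6) * p ^ 6 := by gcongr
    _ = 2 ^ 20 * (n : ℝ) ^ 2 * p ^ 2 / 6 := by field_simp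

theorem disjoint_bad_localized_pairs_prob (n : ℕ) (hn : 1 ≤ n) (p : ℝ)
    (hp0 : 0 ≤ p) (hp1 : p ≤ 1) (hnp : (n : ℝ) * p ^ 2 < 3) :
    gameMeasure n p
        {ω | ∃ a b : Fin ⌈(n : ℝ) / 100⌉₊ → Fin n,
          (∀ k, (a k : ℕ) < (b k : ℕ) ∧
            ((b k : ℝ) - (a k : ℝ)) ≤ 2 ^ 20 / ((n : ℝ) ^ 2 * p ^ 4)) ∧
          Function.Injective a ∧ Function.Injective b ∧
          (∀ k k', a k ≠ b k') ∧
          (∀ k, ∃ S : Finset (Fin n), 3 ≤ S.card ∧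
            ∀ j ∈ S, ω.2 (a k) j = true ∧ ω.2 (b k) j = true)}
      ≤ ENNReal.ofReal
          ((Real.exp 1 ^ 4 * 2 ^ 20 * (n : ℝ) ^ 2 * p ^ 2 /
              (27 * (⌈(n : ℝ) / 100⌉₊ : ℝ))) ^ (⌈(n : ℝ) / 100⌉₊ : ℕ)) := by
  classical
  set t := ⌈(n : ℝ) / 100⌉₊
  set W := localizedPairs n (2 ^ 20 / ((n : ℝ) ^ 2 * p ^ 4)) ×ˢ
    powersetCard 3 (univ : Finset (Fin n)) with hW
  have hWp : (W.card : ℝ) * p ^ 6 ≤ 2 ^ 20 * (n : ℝ) ^ 2 * p ^ 2 / 6 :=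
    card_witnesses_mul_pow_le hn hp0
  set 𝓕 := (powersetCard t W).filter fun F => (F.biUnion witnessCells).card = 6 * t with h𝓕
  calc _ ≤ gameMeasure n p (⋃ F ∈ 𝓕,
        {ω | ∀ c ∈ F.biUnion witnessCells, ω.2 c.1 c.2 = true}) := by
        refine measure_mono ?_
        rintro ω ⟨a, b, hloc, ha, hb, hab, hbad⟩
        choose T hT hTω using hbad
        choose S hST hS using fun k => Finset.exists_subset_card_eq (hT k)
        simp only [Set.mem_iUnion, exists_prop]
        refine ⟨univ.image fun k => ((a k, b k), S k), ?_, ?_⟩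
        · rw [h𝓕, mem_filter, mem_powersetCard]
          refine ⟨⟨?_, ?_⟩, card_biUnion_witnessCells ha hb hab hS⟩
          · intro x hx
            obtain ⟨k, -, rfl⟩ := mem_image.1 hx
            simpa [hW, localizedPairs, hS] using hloc k
          · rw [Finset.card_image_of_injective, Finset.card_univ, Fintype.card_fin]
            intro k k' h
            exact ha (congrArg (fun x => x.1.1) h)
        · rintro ⟨r, c⟩ hrc
          simp only [mem_biUnion, mem_image, mem_univ, true_and, witnessCells] at hrc
          obtain ⟨_, ⟨k, rfl⟩, hrc⟩ := hrc
          simp only [mem_product, mem_insert, mem_singleton] at hrc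
          obtain ⟨rfl | rfl, hc⟩ := hrc
          · exact (hTω k c (hST k hc)).1
          · exact (hTω k c (hST k hc)).2
    _ ≤ ∑ F ∈ 𝓕, ENNReal.ofReal p ^ (6 * t) := by
        refine (measure_biUnion_finset_le _ _).trans (Finset.sum_le_sum fun F hF => ?_)
        rw [gameMeasure_forall_cells hp0 hp1, (mem_filter.1 hF).2]
    _ ≤ (W.card.choose t : ℝ≥0∞) * ENNReal.ofReal p ^ (6 * t) := by
        rw [Finset.sum_const, nsmul_eq_mul, ← Finset.card_powersetCard]
        gcongr
        exact Finset.filter_subset _ _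
    _ = ENNReal.ofReal (W.card.choose t * p ^ (6 * t)) := by
        rw [ENNReal.ofReal_mul (by positivity), ENNReal.ofReal_natCast, ENNReal.ofReal_pow hp0]
    _ ≤ _ := by
        refine ENNReal.ofReal_le_ofReal ?_
        have he : (2 : ℝ) ≤ Real.exp 1 := by linarith [Real.add_one_le_exp (1 : ℝ)]
        have he3 : (27 : ℝ) / 6 ≤ Real.exp 1 ^ 3 := by
          calc (27 : ℝ) / 6 ≤ 2 ^ 3 := by norm_num
            _ ≤ Real.exp 1 ^ 3 := by gcongr
        calc (W.card.choose t : ℝ) * p ^ (6 * t)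
            ≤ (Real.exp 1 * W.card / t) ^ t * p ^ (6 * t) := by
              gcongr
              exact choose_le_exp_mul_div_pow _ _
          _ = (Real.exp 1 * (W.card * p ^ 6) / t) ^ t := by
              rw [pow_mul, ← mul_pow]; ring
          _ ≤ (Real.exp 1 * (2 ^ 20 * (n : ℝ) ^ 2 * p ^ 2 / 6) / t) ^ t := by gcongr
          _ = (Real.exp 1 * (2 ^ 20 * (n : ℝ) ^ 2 * p ^ 2 / 27 * (27 / 6)) / t) ^ t := by
              ring
          _ ≤ (Real.exp 1 * (2 ^ 20 * (n : ℝ) ^ 2 * p ^ 2 / 27 * Real.exp 1 ^ 3) / t) ^ t := by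
              gcongr
          _ = _ := by
              congr 1
              rw [← div_div]; ring
end
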